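/- arXiv:1004.1420 — 3 statements merged into one kernel-verified Lean document; each statement's English description precedes it below -/
import Mathlib

section
/- The subspace of the exterior algebra ⋀U consisting of elements fixed by T_i for every i in I = {1, 2, …, 2m} has dimension m + 1 over ℚ. (Lemma 4.3.3, case 1.) -/
/-!
Setup: `U = ℚ^{2m}` with basis `c_1, …, c_{2m}` (1-based indexing).
`T i` is the linear automorphism with `T i (c_j) = c_j` for `|i - j| ≠ 1`,
`T i (c_{i+1}) = c_{i+1} - c_i`, `T i (c_{i-1}) = c_{i-1} + c_i`;
it induces an algebra endomorphism of the exterior algebra `⋀ U`.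
-/

noncomputable section

/-- 1-based coordinate of `x : Fin n → ℚ`; zero outside `{1, …, n}`. -/
def entry (n : ℕ) (x : Fin n → ℚ) (i : ℕ) : ℚ :=
  if h : 1 ≤ i ∧ i ≤ n then x ⟨i - 1, by omega⟩ else 0

/-- 1-based standard basis vector `c_i` of `ℚ^n`. -/
def bas (n i : ℕ) : Fin n → ℚ := fun j => if (j : ℕ) + 1 = i then 1 else 0

lemma entry_add (n : ℕ) (x y : Fin n → ℚ) (i : ℕ) :
    entry n (x + y) i = entry n x i + entry n y i := by
  unfold entry; split <;> simp

lemma entry_smul (n : ℕ) (c : ℚ) (x : Fin n → ℚ) (i : ℕ) :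
    entry n (c • x) i = c * entry n x i := by
  unfold entry; split <;> simp

/-- The operator `T_i` on `ℚ^n`:  `T_i x = x + (x_{i-1} - x_{i+1}) • c_i`,
which is exactly `T_i (c_j) = c_j` for `|i-j| ≠ 1`, `T_i (c_{i+1}) = c_{i+1} - c_i`,
`T_i (c_{i-1}) = c_{i-1} + c_i`. -/
def T (n i : ℕ) : (Fin n → ℚ) →ₗ[ℚ] (Fin n → ℚ) where
  toFun x := x + (entry n x (i - 1) - entry n x (i + 1)) • bas n i
  map_add' x y := by
    simp only [entry_add, add_smul, sub_smul]
    abel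
  map_smul' c x := by
    simp only [entry_smul, RingHom.id_apply, smul_add, smul_smul, mul_sub]

/-- The induced algebra endomorphism of the exterior algebra. -/
def extT (n i : ℕ) :
    ExteriorAlgebra ℚ (Fin n → ℚ) →ₐ[ℚ] ExteriorAlgebra ℚ (Fin n → ℚ) :=
  ExteriorAlgebra.map (T n i)

/-- The subspace of `⋀ U` of elements fixed by `T_i` for all `i ∈ I`. -/
def invSub (n : ℕ) (I : Set ℕ) : Submodule ℚ (ExteriorAlgebra ℚ (Fin n → ℚ)) :=
  ⨅ i ∈ I, LinearMap.eqLocus (extT n i).toLinearMap LinearMap.id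

namespace InvAux

abbrev V (n : ℕ) := Fin n → ℚ
abbrev A (n : ℕ) := ExteriorAlgebra ℚ (Fin n → ℚ)

/-- left multiplication -/
def a {n : ℕ} : V n →ₗ[ℚ] A n →ₗ[ℚ] A n :=
  (LinearMap.mul ℚ (A n)) ∘ₗ (ExteriorAlgebra.ι ℚ)

/-- contraction -/
def c {n : ℕ} : Module.Dual ℚ (V n) →ₗ[ℚ] A n →ₗ[ℚ] A n :=
  CliffordAlgebra.contractLeft

variable {n : ℕ}

lemma a_apply (u : V n) (x : A n) : a u x = ExteriorAlgebra.ι ℚ u * x := rfl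

lemma a_self (u : V n) (x : A n) : a u (a u x) = 0 := by
  simp only [a_apply]
  rw [← mul_assoc, ExteriorAlgebra.ι_sq_zero, zero_mul]

lemma aa (u v : V n) (x : A n) : a u (a v x) = - a v (a u x) := by
  have := a_self (u + v) x
  simp only [map_add, LinearMap.add_apply, a_self] at this
  rw [zero_add, add_zero] at this
  exact eq_neg_of_add_eq_zero_right this

lemma cc (p q : Module.Dual ℚ (V n)) (x : A n) : c p (c q x) = - c q (c p x) :=
  CliffordAlgebra.contractLeft_comm _ _ _

lemma c_self (p : Module.Dual ℚ (V n)) (x : A n) : c p (c p x) = 0 :=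
  CliffordAlgebra.contractLeft_contractLeft _ _

lemma ca (p : Module.Dual ℚ (V n)) (v : V n) (x : A n) :
    c p (a v x) = p v • x - a v (c p x) :=
  CliffordAlgebra.contractLeft_ι_mul _ _ _

lemma c_one (p : Module.Dual ℚ (V n)) : c p (1 : A n) = 0 :=
  CliffordAlgebra.contractLeft_one _ _

lemma A_ind {P : A n → Prop} (h1 : P 1) (hs : ∀ (r : ℚ) x, P x → P (r • x))
    (hadd : ∀ x y, P x → P y → P (x + y)) (hm : ∀ v x, P x → P (a v x)) : ∀ x, P x := by
  intro x
  induction x using CliffordAlgebra.left_induction with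
  | algebraMap r => rw [Algebra.algebraMap_eq_smul_one]; exact hs _ _ h1
  | add _ _ hx hy => exact hadd _ _ hx hy
  | ι_mul x m hx => exact hm _ _ hx

/-- transvection acts as 1 + N -/
lemma map_transv (f : V n →ₗ[ℚ] V n) (u : V n) (p : Module.Dual ℚ (V n))
    (hf : ∀ x, f x = x + p x • u) (x : A n) :
    ExteriorAlgebra.map f x = x + a u (c p x) := by
  induction x using A_ind with
  | h1 => simp [c_one]
  | hs r x hx => simp [hx]
  | hadd x y hx hy => simp only [map_add, hx, hy]; abel
  | hm v x hx =>
    rw [a_apply v, map_mul, ExteriorAlgebra.map_apply_ι, ← a_apply, ← a_apply, hx, hf, ca]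
    simp only [map_add, map_sub, map_smul, LinearMap.add_apply, LinearMap.smul_apply, a_self,
      smul_zero]
    rw [aa v u]
    abel

/-- basis vector -/
abbrev e (i : Fin n) : V n := Pi.single i 1
abbrev d (i : Fin n) : A n →ₗ[ℚ] A n := c (LinearMap.proj i)

lemma sum_a (x : V n) (y : A n) : ∑ i, x i • a (e i) y = a x y := by
  conv_rhs => rw [show x = ∑ i, x i • e i from by
    funext j; simp [Finset.sum_apply, Pi.single_apply]]
  simp [LinearMap.sum_apply]

lemma sum_d (p : Module.Dual ℚ (V n)) (y : A n) : ∑ i, p (e i) • d i y = c p y := by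
  conv_rhs => rw [show p = ∑ i, p (e i) • LinearMap.proj i from by
    apply LinearMap.pi_ext'; intro j; ext; simp [Pi.single_apply]]
  simp [LinearMap.sum_apply]

/-- Euler operator -/
def E : A n →ₗ[ℚ] A n := ∑ i, a (e i) ∘ₗ d i

lemma E_apply (x : A n) : E x = ∑ i, a (e i) (d i x) := by
  simp [E]

lemma E_a (v : V n) (x : A n) : E (a v x) = a v (E x) + a v x := by
  simp only [E_apply, ca, map_sub, map_smul, LinearMap.proj_apply, Finset.sum_sub_distrib, sum_a,
    map_sum]
  simp only [aa _ v, Finset.sum_neg_distrib]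
  abel

lemma E_c (p : Module.Dual ℚ (V n)) (x : A n) : E (c p x) = c p (E x) - c p x := by
  simp only [E_apply, ca, map_sum, Finset.sum_sub_distrib, sum_d, d]
  simp only [cc p, map_neg, Finset.sum_neg_distrib]
  abel

lemma E_one : E (1 : A n) = 0 := by simp [E_apply, c_one]

lemma sum_da (x : A n) : ∑ i, d i (a (e i) x) = (n : ℚ) • x - E x := by
  simp only [ca, Finset.sum_sub_distrib, E_apply]
  simp [Nat.cast_smul_eq_nsmul]

/-! grading -/
abbrev G (n : ℕ) (k : ℕ) : Submodule ℚ (A n) := ⋀[ℚ]^k (V n)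

lemma E_G (k : ℕ) : ∀ x ∈ G n k, E x = (k : ℚ) • x := by
  suffices h : ∀ v : Fin k → V n, E (ExteriorAlgebra.ιMulti ℚ k v)
      = (k : ℚ) • ExteriorAlgebra.ιMulti ℚ k v by
    intro x hx
    rw [G, ← ExteriorAlgebra.ιMulti_span_fixedDegree] at hx
    induction hx using Submodule.span_induction with
    | mem x hx => obtain ⟨v, rfl⟩ := hx; exact h v
    | zero => simp
    | add x y _ _ hx hy => simp [hx, hy]
    | smul r x _ hx => rw [map_smul, hx, smul_comm]
  induction k with
  | zero => intro v; simp [E_one]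
  | succ k ih =>
    intro v
    rw [ExteriorAlgebra.ιMulti_succ_apply, ← a_apply, E_a, ih, map_smul]
    push_cast
    rw [add_smul, one_smul]

lemma G_bot (k : ℕ) (hk : n < k) : ∀ x ∈ G n k, x = 0 := by
  intro x hx
  rw [G, ← ExteriorAlgebra.ιMulti_span_fixedDegree] at hx
  induction hx using Submodule.span_induction with
  | mem x hx =>
    obtain ⟨v, rfl⟩ := hx
    apply AlternatingMap.map_linearDependent
    intro h
    have := h.fintype_card_le_finrank
    simp at this
    omega
  | zero => rfl
  | add x y _ _ hx hy => simp [hx, hy]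
  | smul r x _ hx => simp [hx]

/-- homogeneous component -/
def comp (k : ℕ) : A n →ₗ[ℚ] A n := GradedAlgebra.proj (G n) k

lemma comp_mem (k : ℕ) (x : A n) : comp k x ∈ G n k := by
  simp [comp, GradedAlgebra.proj_apply]

lemma comp_same {k : ℕ} {x : A n} (hx : x ∈ G n k) : comp k x = x :=
  DirectSum.decompose_of_mem_same _ hx

lemma comp_ne {k l : ℕ} {x : A n} (hx : x ∈ G n k) (h : k ≠ l) : comp l x = 0 :=
  DirectSum.decompose_of_mem_ne _ hx h

lemma mem_of_comp (S : Submodule ℚ (A n)) (x : A n) (h : ∀ k ≤ n, comp k x ∈ S) : x ∈ S := by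
  classical
  rw [← DirectSum.sum_support_decompose (G n) x]
  refine Submodule.sum_mem _ fun k _ => ?_
  by_cases hk : k ≤ n
  · exact h k hk
  · have := G_bot k (by omega) _ (comp_mem k x)
    change comp k x ∈ S
    rw [this]; exact S.zero_mem

lemma comp_comm (f : A n →ₗ[ℚ] A n) (hf : ∀ k, ∀ x ∈ G n k, f x ∈ G n k) (k : ℕ) (x : A n) :
    comp k (f x) = f (comp k x) := by
  induction x using DirectSum.Decomposition.inductionOn (G n) with
  | zero => simp
  | @homogeneous i y =>
    by_cases h : i = k
    · subst h; rw [comp_same (hf _ _ y.2), comp_same y.2]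
    · rw [comp_ne (hf _ _ y.2) h, comp_ne y.2 h, map_zero]
  | add x y hx hy => simp [hx, hy]

lemma comp_E (k : ℕ) (x : A n) : comp k (E x) = (k : ℚ) • comp k x := by
  rw [comp_comm, E_G _ _ (comp_mem k x)]
  intro k x hx
  rw [E_G _ _ hx]; exact Submodule.smul_mem _ _ hx

lemma comp_eig {r : ℚ} {x : A n} (hx : E x = r • x) (k : ℕ) (h : r ≠ k) : comp k x = 0 := by
  have h1 := comp_E k x
  rw [hx, map_smul, ← sub_eq_zero, ← sub_smul] at h1
  exact (smul_eq_zero.1 h1).resolve_left (sub_ne_zero.2 h)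

lemma eig_zero {r : ℚ} {x : A n} (hx : E x = r • x) (h : ∀ k ≤ n, r ≠ (k : ℕ)) : x = 0 := by
  rw [← Submodule.mem_bot ℚ]
  refine mem_of_comp _ _ fun k hk => ?_
  rw [comp_eig hx k (h k hk)]; exact Submodule.zero_mem _

lemma eig_mem {k : ℕ} {x : A n} (hx : E x = (k : ℚ) • x) : x ∈ G n k := by
  refine mem_of_comp _ _ fun l hl => ?_
  by_cases h : k = l
  · subst h; exact comp_mem _ _
  · rw [comp_eig hx l (by exact_mod_cast h)]; exact Submodule.zero_mem _

section sympl

variable (φ : V n →ₗ[ℚ] Module.Dual ℚ (V n)) (g : Fin n → V n)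

/-- invariants of the full symplectic Lie algebra -/
def Inv : Submodule ℚ (A n) where
  carrier := {x | ∀ u v, a u (c (φ v) x) + a v (c (φ u) x) = 0}
  zero_mem' := by simp
  add_mem' := by
    intro x y hx hy u v
    simp only [Set.mem_ofPred_eq] at hx hy
    have := congrArg₂ (· + ·) (hx u v) (hy u v)
    simp only [add_zero] at this
    rw [← this]; simp only [map_add]; abel
  smul_mem' := by
    intro r x hx u v
    simp only [Set.mem_ofPred_eq] at hx
    simp only [map_smul]
    rw [← smul_add, hx, smul_zero]

lemma mem_Inv {x : A n} : x ∈ Inv φ ↔ ∀ u v, a u (c (φ v) x) + a v (c (φ u) x) = 0 := Iff.rfl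

lemma mem_Inv' {x : A n} : x ∈ Inv φ ↔ ∀ u, a u (c (φ u) x) = 0 := by
  rw [mem_Inv]
  constructor
  · intro h u
    have := h u u
    rw [← two_smul ℚ] at this
    exact (smul_eq_zero.1 this).resolve_left (by norm_num)
  · intro h u v
    have := h (u + v)
    simp only [map_add, LinearMap.add_apply, h] at this
    rw [← this]; abel

lemma bracket (hs : ∀ u v, φ u v = - φ v u) {u v : V n} {x : A n} (hu : a u (c (φ u) x) = 0)
    (hv : a v (c (φ v) x) = 0) (huv : φ u v ≠ 0) : a (u + v) (c (φ (u + v)) x) = 0 := by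
  have h1 : a u (c (φ u) (a v (c (φ v) x))) = 0 := by rw [hv]; simp
  have h2 : a v (c (φ v) (a u (c (φ u) x))) = 0 := by rw [hu]; simp
  rw [ca] at h1 h2
  rw [hs v u] at h2
  simp only [map_sub, map_smul] at h1 h2
  rw [aa v u, cc (φ v) (φ u)] at h2
  simp only [map_neg, neg_neg, neg_smul] at h2
  have h3 : φ u v • (a u (c (φ v) x) + a v (c (φ u) x)) = 0 := by
    have := congrArg₂ (· - ·) h1 h2
    simp only [sub_zero] at this
    rw [← this, smul_add]; abel
  have h4 := (smul_eq_zero.1 h3).resolve_left huv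
  simp only [map_add, LinearMap.add_apply, hu, hv]
  rw [zero_add, add_zero, add_comm]; exact h4

/-- contraction with the form -/
def M : A n →ₗ[ℚ] A n := ∑ i, d i ∘ₗ c (φ (e i))

lemma M_apply (x : A n) : M φ x = ∑ i, d i (c (φ (e i)) x) := by simp [M]

lemma sum_c (u : V n) (y : A n) : ∑ i, u i • c (φ (e i)) y = c (φ u) y := by
  conv_rhs => rw [show u = ∑ i, u i • e i from by
    funext j; simp [Finset.sum_apply, Pi.single_apply]]
  simp [LinearMap.sum_apply]

lemma sum_d' (hs : ∀ u v, φ u v = - φ v u) (u : V n) (y : A n) :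
    ∑ i, φ (e i) u • d i y = - c (φ u) y := by
  rw [← sum_d, ← Finset.sum_neg_distrib]
  refine Finset.sum_congr rfl fun i _ => ?_
  rw [hs, neg_smul]

lemma M_c (p : Module.Dual ℚ (V n)) (x : A n) : M φ (c p x) = c p (M φ x) := by
  simp only [M_apply, map_sum]
  refine Finset.sum_congr rfl fun i _ => ?_
  rw [cc _ p, map_neg, cc _ p, neg_neg]

lemma M_a (hs : ∀ u v, φ u v = - φ v u) (u : V n) (x : A n) :
    M φ (a u x) = a u (M φ x) - (2 : ℚ) • c (φ u) x := by
  simp only [M_apply, ca, map_sub, map_smul, Finset.sum_sub_distrib, sum_d' φ hs, map_sum,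
    LinearMap.proj_apply, sum_c]
  rw [two_smul]; abel

lemma M_Inv (hs : ∀ u v, φ u v = - φ v u) {x : A n} (hx : x ∈ Inv φ) : M φ x ∈ Inv φ := by
  rw [mem_Inv'] at hx ⊢
  intro u
  have := congrArg (M φ) (hx u)
  rw [M_a φ hs, M_c, c_self, map_zero, smul_zero, sub_zero] at this
  exact this

lemma M_E (x : A n) : E (M φ x) = M φ (E x) - (2 : ℚ) • M φ x := by
  simp only [M_apply, map_sum, E_c, map_sub, Finset.sum_sub_distrib, two_smul]
  abel

lemma key1 {x : A n} (hx : x ∈ Inv φ) (v : V n) :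
    c (φ v) (((n : ℚ) + 2) • x - E x) = a v (M φ x) := by
  have h : ∑ i, d i (a (e i) (c (φ v) x) + a v (c (φ (e i)) x)) = 0 := by
    refine Finset.sum_eq_zero fun i _ => ?_
    rw [(mem_Inv φ).1 hx, map_zero]
  simp only [map_add, Finset.sum_add_distrib] at h
  rw [sum_da, E_c] at h
  simp only [ca, Finset.sum_sub_distrib, LinearMap.proj_apply, sum_c] at h
  rw [← map_sum, ← M_apply] at h
  rw [← sub_eq_zero, ← h, map_sub, map_smul, add_smul, two_smul]
  abel

/-- wedge with the bivector -/
def L : A n →ₗ[ℚ] A n := ∑ j, a (g j) ∘ₗ a (e j)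

lemma L_apply (x : A n) : L g x = ∑ j, a (g j) (a (e j) x) := by simp [L]

lemma L_a (v : V n) (x : A n) : L g (a v x) = a v (L g x) := by
  simp only [L_apply, map_sum]
  refine Finset.sum_congr rfl fun i _ => ?_
  rw [aa _ v, map_neg, aa _ v, neg_neg]

lemma L_E (x : A n) : E (L g x) = L g (E x) + (2 : ℚ) • L g x := by
  simp only [L_apply, map_sum, E_a, map_add, Finset.sum_add_distrib, two_smul]
  abel

variable (hs : ∀ u v, φ u v = - φ v u) (hg : ∀ x, x = ∑ j, φ (e j) x • g j)

include hg in
lemma E_eq (x : A n) : ∑ j, a (g j) (c (φ (e j)) x) = E x := by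
  rw [E_apply]
  simp only [← sum_d (φ _) x, map_sum, map_smul]
  rw [Finset.sum_comm]
  refine Finset.sum_congr rfl fun i _ => ?_
  conv_rhs => rw [hg (e i)]
  simp [LinearMap.sum_apply]

include hg in
lemma key2 {x : A n} (hx : x ∈ Inv φ) :
    E (((n : ℚ) + 2) • x - E x) = L g (M φ x) := by
  rw [← E_eq φ g hg, L_apply]
  simp only [key1 φ hx]

include hs hg in
lemma dual_sum (u : V n) : ∑ j, φ u (g j) • e j = u := by
  have hu : ∀ w, φ w (∑ j, φ u (g j) • e j - u) = 0 := by
    intro w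
    rw [map_sub, map_sum]
    have : φ w u = - φ u w := hs _ _
    rw [this]
    have hw : φ u w = ∑ j, φ (e j) w * φ u (g j) := by
      conv_lhs => rw [hg w]
      simp only [map_sum, map_smul, smul_eq_mul]
    rw [hw, sub_neg_eq_add, ← Finset.sum_add_distrib]
    refine Finset.sum_eq_zero fun j _ => ?_
    rw [map_smul, smul_eq_mul, hs w]; ring
  rw [← sub_eq_zero, hg (∑ j, φ u (g j) • e j - u)]
  simp [hu]

include hs hg in
lemma c_L (u : V n) (x : A n) : c (φ u) (L g x) = (2 : ℚ) • a u x + L g (c (φ u) x) := by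
  simp only [L_apply, map_sum, ca, map_sub, map_smul, Finset.sum_sub_distrib]
  have h1 : ∑ j, φ u (g j) • a (e j) x = a u x := by
    conv_rhs => rw [← dual_sum φ g hs hg u]
    simp [LinearMap.sum_apply]
  have h2 : ∑ j, φ u (e j) • a (g j) x = - a u x := by
    conv_rhs => rw [hg u]
    simp only [map_sum, LinearMap.sum_apply, map_smul, LinearMap.smul_apply,
      ← Finset.sum_neg_distrib]
    refine Finset.sum_congr rfl fun i _ => ?_
    rw [hs, neg_smul]
  rw [h1, h2, two_smul]; abel

include hs hg in
lemma L_Inv {x : A n} (hx : x ∈ Inv φ) : L g x ∈ Inv φ := by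
  rw [mem_Inv'] at hx ⊢
  intro u
  rw [c_L φ g hs hg, map_add, map_smul, a_self, smul_zero, zero_add, ← L_a, hx, map_zero]

/-- powers of the bivector -/
def w (j : ℕ) : A n := (L g)^[j] 1

lemma w_succ (j : ℕ) : w g (j + 1) = L g (w g j) := Function.iterate_succ_apply' _ _ _

lemma E_w (j : ℕ) : E (w g j) = (2 * j : ℚ) • w g j := by
  induction j with
  | zero => simp [w, E_one]
  | succ j ih =>
    rw [w_succ, L_E, ih, map_smul, ← add_smul]
    push_cast; ring_nf

include hs hg in
lemma w_Inv (j : ℕ) : w g j ∈ Inv φ := by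
  induction j with
  | zero => rw [mem_Inv]; simp [w, c_one]
  | succ j ih => rw [w_succ]; exact L_Inv φ g hs hg ih

include hs hg in
lemma c_w (j : ℕ) (u : V n) : c (φ u) (w g (j + 1)) = (2 * (j + 1) : ℚ) • a u (w g j) := by
  induction j with
  | zero => rw [w_succ, c_L φ g hs hg]; simp [w, c_one]
  | succ j ih =>
    rw [w_succ, c_L φ g hs hg, ih, map_smul, L_a, ← w_succ, ← add_smul]
    push_cast; ring_nf

include hs hg in
lemma w_ne (m : ℕ) (hn : n = 2 * m) (j : ℕ) (hj : j ≤ m) : w g j ≠ 0 := by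
  induction j with
  | zero => simp [w]
  | succ j ih =>
    intro h
    apply ih (by omega)
    have h1 : ∀ u, a u (w g j) = 0 := by
      intro u
      have := c_w φ g hs hg j u
      rw [h, map_zero] at this
      exact (smul_eq_zero.1 this.symm).resolve_left (by positivity)
    have h2 := sum_da (w g j)
    simp only [h1, map_zero, Finset.sum_const_zero] at h2
    rw [E_w, ← sub_smul] at h2
    refine (smul_eq_zero.1 h2.symm).resolve_left ?_
    rw [hn]; push_cast
    have : (j : ℚ) + 1 ≤ m := by exact_mod_cast hj
    intro h; linarith

/-- span of powers -/
def W (m : ℕ) : Submodule ℚ (A n) := Submodule.span ℚ (Set.range fun j : Fin (m + 1) => w g j)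

lemma w_mem (m : ℕ) (hn : n = 2 * m) (j : ℕ) : w g j ∈ W g m := by
  by_cases h : j ≤ m
  · exact Submodule.subset_span ⟨⟨j, by omega⟩, rfl⟩
  · have : w g j = 0 := by
      refine eig_zero (E_w g j) fun k hk h' => ?_
      have : 2 * j = k := by exact_mod_cast h'
      omega
    rw [this]; exact Submodule.zero_mem _

lemma L_W (m : ℕ) (hn : n = 2 * m) {x : A n} (hx : x ∈ W g m) : L g x ∈ W g m := by
  induction hx using Submodule.span_induction with
  | mem x hx => obtain ⟨j, rfl⟩ := hx; simp only [← w_succ]; exact w_mem g m hn _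
  | zero => simp
  | add x y _ _ hx hy => rw [map_add]; exact Submodule.add_mem _ hx hy
  | smul r x _ hx => rw [map_smul]; exact Submodule.smul_mem _ _ hx

include hs hg in
lemma eig_W (m : ℕ) (hn : n = 2 * m) (k : ℕ) : ∀ x ∈ Inv φ, E x = (k : ℚ) • x → x ∈ W g m := by
  induction k using Nat.strong_induction_on with
  | _ k ih =>
    intro x hx hE
    by_cases hk : n < k
    · have : x = 0 := eig_zero hE fun l hl h => by
        have : k = l := by exact_mod_cast h
        omega
      rw [this]; exact Submodule.zero_mem _
    rcases Nat.eq_zero_or_pos k with rfl | hk0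
    · have := eig_mem hE
      simp only [G, pow_zero, Submodule.mem_one] at this
      obtain ⟨r, rfl⟩ := this
      rw [Algebra.algebraMap_eq_smul_one]
      exact Submodule.smul_mem _ _ (w_mem g m hn 0)
    have h2 := key2 φ g hg hx
    rw [hE, map_sub, map_smul, map_smul, hE, ← sub_smul, smul_smul] at h2
    have hM : M φ x ∈ W g m := by
      have hME : E (M φ x) = ((k : ℚ) - 2) • M φ x := by
        rw [M_E, hE, map_smul, sub_smul]
      by_cases h1 : k = 1
      · have : M φ x = 0 := eig_zero hME fun l hl h => by
          have h3 : (0 : ℚ) ≤ l := by positivity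
          rw [← h, h1] at h3; norm_num at h3
        rw [this]; exact Submodule.zero_mem _
      · refine ih (k - 2) (by omega) _ (M_Inv φ hs hx) ?_
        rw [hME]; push_cast [show 2 ≤ k by omega]; rfl
    have h3 := L_W g m hn hM
    rw [← h2] at h3
    refine (Submodule.smul_mem_iff _ ?_).1 h3
    have h4 : (k : ℚ) ≤ n := by exact_mod_cast not_lt.1 hk
    have h5 : (0 : ℚ) < k := by exact_mod_cast hk0
    apply mul_ne_zero
    · intro h; linarith
    · exact h5.ne'

lemma comp_Inv {x : A n} (hx : x ∈ Inv φ) (k : ℕ) : comp k x ∈ Inv φ := by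
  rw [mem_Inv'] at hx ⊢
  intro u
  have := comp_comm (a u ∘ₗ c (φ u)) (fun k y hy => by
    apply eig_mem
    rw [LinearMap.comp_apply, E_a, E_c, E_G k y hy]
    simp) k x
  simp only [LinearMap.comp_apply, hx, map_zero] at this
  exact this.symm

include hs hg in
lemma Inv_eq (m : ℕ) (hn : n = 2 * m) : Inv φ = W g m := by
  apply le_antisymm
  · intro x hx
    exact mem_of_comp _ _ fun k _ =>
      eig_W φ g hs hg m hn k _ (comp_Inv φ hx k) (E_G _ _ (comp_mem k x))
  · rw [W, Submodule.span_le]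
    rintro _ ⟨j, rfl⟩
    exact w_Inv φ g hs hg _

include hs hg in
lemma finrank_Inv (m : ℕ) (hn : n = 2 * m) : Module.finrank ℚ (Inv φ) = m + 1 := by
  rw [Inv_eq φ g hs hg m hn, W, finrank_span_eq_card]
  · simp
  · refine Module.End.eigenvectors_linearIndependent' (E : Module.End ℚ (A n))
      (fun j : Fin (m + 1) => (2 * (j : ℕ) : ℚ)) ?_ _ ?_
    · intro i j h
      simp only [mul_eq_mul_left_iff, OfNat.ofNat_ne_zero, or_false, Nat.cast_inj] at h
      exact Fin.ext h
    · intro j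
      exact ⟨Module.End.mem_eigenspace_iff.2 (E_w g j), w_ne φ g hs hg m hn j (by omega)⟩

end sympl

/-! the concrete form -/

/-- entry as a linear map -/
def entryL (n i : ℕ) : Module.Dual ℚ (V n) where
  toFun x := entry n x i
  map_add' x y := entry_add n x y i
  map_smul' r x := by simp [entry_smul]

def phi (n : ℕ) : V n →ₗ[ℚ] Module.Dual ℚ (V n) :=
  ∑ j : Fin n, (LinearMap.proj j).smulRight (entryL n j - entryL n (j + 2))

lemma phi_apply (u v : V n) : phi n u v = ∑ j : Fin n, u j * (entry n v j - entry n v (j + 2)) := by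
  simp [phi, entryL, LinearMap.sum_apply]

lemma bas_eq (j : Fin n) : bas n (j + 1) = e j := by
  funext k
  simp [bas, Pi.single_apply, Fin.ext_iff]

lemma phi_e (j : Fin n) (v : V n) : phi n (e j) v = entry n v j - entry n v (j + 2) := by
  rw [phi_apply]; simp [Pi.single_apply]

lemma entry_e (k : Fin n) (i : ℕ) : entry n (e k) i = if (k : ℕ) + 1 = i then 1 else 0 := by
  unfold entry
  simp only [Pi.single_apply, Fin.ext_iff]
  have := k.2
  split_ifs <;> first | rfl | omega

lemma phi_ee (j k : Fin n) : phi n (e j) (e k) =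
    (if (k : ℕ) + 1 = j then 1 else 0) - (if (k : ℕ) = j + 1 then 1 else 0) := by
  rw [phi_e, entry_e, entry_e]; simp

lemma phi_skew (u v : V n) : phi n u v = - phi n v u := by
  have : phi n = - (phi n).flip := by
    apply LinearMap.pi_ext'; intro j
    apply LinearMap.ext_ring
    apply LinearMap.pi_ext'; intro k
    apply LinearMap.ext_ring
    simp only [LinearMap.comp_apply, LinearMap.single_apply, LinearMap.neg_apply,
      LinearMap.flip_apply]
    rw [phi_ee, phi_ee]
    simp only [eq_comm]
    ring
  conv_lhs => rw [this]
  rfl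

lemma phi_nondeg (m : ℕ) (x : V (2 * m)) (h : ∀ j, phi (2 * m) (e j) x = 0) : x = 0 := by
  simp only [phi_e, sub_eq_zero] at h
  have h1 : ∀ k, k ≤ m → entry (2 * m) x (2 * k) = 0 := by
    intro k
    induction k with
    | zero => intro _; simp [entry]
    | succ k ih =>
      intro hk
      rw [← ih (by omega)]
      exact (h ⟨2 * k, by omega⟩).symm
  have h2 : ∀ k, k ≤ m → entry (2 * m) x (2 * (m - k) + 1) = 0 := by
    intro k
    induction k with
    | zero => intro _; simp [entry]
    | succ k ih =>
      intro hk
      rw [← ih (by omega)]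
      have := h ⟨2 * (m - (k + 1)) + 1, by omega⟩
      simp only at this
      rw [this]
      congr 1; omega
  funext j
  have hj : entry (2 * m) x (j + 1) = x j := by
    have := j.2
    simp [entry]
  rw [← hj]
  rcases Nat.even_or_odd' (j : ℕ) with ⟨k, hk | hk⟩
  · have := h2 (m - k) (by omega)
    rw [hk]
    rw [show m - (m - k) = k by omega] at this
    exact this
  · have := h1 (k + 1) (by omega)
    rw [hk]
    exact this

lemma exists_g (m : ℕ) : ∃ g : Fin (2 * m) → V (2 * m),
    ∀ x, x = ∑ j, phi (2 * m) (e j) x • g j := by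
  let J : V (2 * m) →ₗ[ℚ] V (2 * m) := LinearMap.pi fun j => phi (2 * m) (e j)
  have hJ : LinearMap.ker J = ⊥ := by
    rw [LinearMap.ker_eq_bot']
    intro x hx
    exact phi_nondeg m x fun j => congrFun hx j
  obtain ⟨K, hK⟩ := LinearMap.exists_leftInverse_of_injective J hJ
  refine ⟨fun j => K (e j), fun x => ?_⟩
  have h1 : K (J x) = x := LinearMap.congr_fun hK x
  have h2 : J x = ∑ j, phi (2 * m) (e j) x • e j := by
    funext i; simp [J, Finset.sum_apply, Pi.single_apply]
  conv_lhs => rw [← h1, h2]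
  simp

/-- prefix sums -/
def S (n k : ℕ) : V n := ∑ i ∈ Finset.range k, bas n (i + 1)

lemma S_succ (k : ℕ) : S n (k + 1) = S n k + bas n (k + 1) := Finset.sum_range_succ _ _

lemma phi_S (k : ℕ) (hk : k < n) (i : ℕ) (hi : i ≤ k): phi n (bas n (k + 1)) (S n i) =
    if i = k ∧ 0 < k then 1 else 0 := by
  rw [S, map_sum]
  have : ∀ l ∈ Finset.range i, phi n (bas n (k + 1)) (bas n (l + 1)) =
      if l + 1 = k then 1 else 0 := by
    intro l hl
    have hl := Finset.mem_range.1 hl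
    rw [bas_eq ⟨k, hk⟩, bas_eq ⟨l, by omega⟩, phi_ee]
    simp only
    rw [if_neg (show ¬ l = k + 1 by omega), sub_zero]
  rw [Finset.sum_congr rfl this]
  rcases k with _ | k
  · simp
  · simp only [Nat.add_right_cancel_iff, Finset.sum_ite_eq', Finset.mem_range]
    congr 1
    simp only [eq_iff_iff]; omega

lemma inv_S {x : A n} (hx : ∀ k < n, a (bas n (k + 1)) (c (phi n (bas n (k + 1))) x) = 0)
    (i j : ℕ) (hij : i < j) (hj : j ≤ n) :
    a (S n j - S n i) (c (phi n (S n j - S n i)) x) = 0 := by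
  induction j, hij using Nat.le_induction with
  | base =>
    rw [S_succ, add_sub_cancel_left]; exact hx _ (by omega)
  | succ j hij ih =>
    rw [S_succ, add_sub_right_comm]
    refine bracket _ phi_skew (ih (by omega)) (hx _ (by omega)) ?_
    rw [phi_skew, map_sub, phi_S _ (by omega) _ le_rfl, phi_S _ (by omega) _ (by omega)]
    rw [if_pos (by omega), if_neg (by omega)]
    norm_num

lemma inv_all {x : A n} (hx : ∀ k < n, a (bas n (k + 1)) (c (phi n (bas n (k + 1))) x) = 0) :
    x ∈ Inv (phi n) := by
  have h0 : ∀ j ≤ n, a (S n j) (c (phi n (S n j)) x) = 0 := by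
    intro j hj
    rcases Nat.eq_zero_or_pos j with rfl | h
    · simp [S]
    · simpa [S] using inv_S hx 0 j h hj
  let B : V n →ₗ[ℚ] V n →ₗ[ℚ] A n :=
    LinearMap.mk₂ ℚ (fun u v => a u (c (phi n v) x) + a v (c (phi n u) x))
      (by intros; simp only [map_add, LinearMap.add_apply]; abel)
      (by intros; simp only [map_smul, LinearMap.smul_apply, smul_add])
      (by intros; simp only [map_add, LinearMap.add_apply]; abel)
      (by intros; simp only [map_smul, LinearMap.smul_apply, smul_add])
  have hB : ∀ u v, B u v = a u (c (phi n v) x) + a v (c (phi n u) x) := fun _ _ => rfl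
  have hBs : ∀ u v, B u v = B v u := fun u v => by rw [hB, hB, add_comm]
  have h1 : ∀ i j, i < j → j ≤ n → B (S n i) (S n j) = 0 := by
    intro i j hij hj
    have := inv_S hx i j hij hj
    simp only [map_sub, LinearMap.sub_apply, h0 i (by omega), h0 j hj] at this
    rw [hB, ← neg_eq_zero, ← this]; abel
  have h2 : ∀ i j, i ≤ n → j ≤ n → B (S n i) (S n j) = 0 := by
    intro i j hi hj
    rcases lt_trichotomy i j with h | rfl | h
    · exact h1 i j h hj
    · rw [hB, h0 i hi, add_zero]
    · rw [hBs]; exact h1 j i h hi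
  have hb : ∀ i : Fin n, e i = S n (i + 1) - S n i := by
    intro i; rw [S_succ, bas_eq]; simp
  have hB0 : B = 0 := by
    apply LinearMap.pi_ext'; intro j
    apply LinearMap.ext_ring
    apply LinearMap.pi_ext'; intro k
    apply LinearMap.ext_ring
    simp only [LinearMap.comp_apply, LinearMap.single_apply, LinearMap.zero_apply]
    have := j.2
    have := k.2
    change B (e j) (e k) = 0
    rw [hb j, hb k]
    simp only [map_sub, LinearMap.sub_apply]
    rw [h2 _ _ (by omega) (by omega), h2 _ _ (by omega) (by omega), h2 _ _ (by omega) (by omega),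
      h2 _ _ (by omega) (by omega)]
    simp
  rw [mem_Inv]
  intro u v
  rw [← hB, hB0]; rfl

lemma T_eq (k : ℕ) (hk : k < n) (x : V n) :
    T n (k + 1) x = x + phi n (bas n (k + 1)) x • bas n (k + 1) := by
  rw [bas_eq ⟨k, hk⟩, phi_e, ← bas_eq ⟨k, hk⟩]
  rfl

lemma invSub_eq (n : ℕ) : invSub n {i | 1 ≤ i ∧ i ≤ n} = Inv (phi n) := by
  ext x
  have h : x ∈ invSub n {i | 1 ≤ i ∧ i ≤ n} ↔
      ∀ k < n, a (bas n (k + 1)) (c (phi n (bas n (k + 1))) x) = 0 := by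
    simp only [invSub, Submodule.mem_iInf, LinearMap.mem_eqLocus, Set.mem_ofPred_eq]
    have key : ∀ k < n, extT n (k + 1) x = x + a (bas n (k + 1)) (c (phi n (bas n (k + 1))) x) :=
      fun k hk => map_transv _ _ _ (T_eq k hk) x
    constructor
    · intro h k hk
      have h1 := h (k + 1) ⟨by omega, by omega⟩
      have h2 := key k hk
      rw [show extT n (k + 1) x = x from h1] at h2
      exact left_eq_add.1 h2
    · rintro h i ⟨hi, hi'⟩
      obtain ⟨k, rfl⟩ : ∃ k, i = k + 1 := ⟨i - 1, by omega⟩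
      change extT n (k + 1) x = x
      rw [key k (by omega), h k (by omega), add_zero]
  rw [h]
  constructor
  · exact inv_all
  · intro h k _
    exact (mem_Inv' _).1 h _

end InvAux

/-- Lemma 4.3.3, case 1: for `I = {1, 2, …, 2m}`, the space of `T_I`-invariants in
`⋀ U` has dimension `m + 1`. -/
theorem invariants_dim_case1 (m : ℕ) (hm : 1 ≤ m) :
    Module.finrank ℚ (invSub (2 * m) {i | 1 ≤ i ∧ i ≤ 2 * m}) = m + 1 := by
  rw [InvAux.invSub_eq]
  obtain ⟨g, hg⟩ := InvAux.exists_g m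
  exact InvAux.finrank_Inv _ g InvAux.phi_skew hg m rfl

end
end

section
/- The subspace of the exterior algebra ⋀U consisting of elements fixed by T_i for every i in I' = {2, 3, …, 2m} has dimension 2m + 1 over ℚ. (Lemma 4.3.3, case 2.) -/
/-!
Setup: `U = ℚ^{2m}` with basis `c_1, …, c_{2m}` (1-based indexing).
`T i` is the linear automorphism with `T i (c_j) = c_j` for `|i - j| ≠ 1`,
`T i (c_{i+1}) = c_{i+1} - c_i`, `T i (c_{i-1}) = c_{i-1} + c_i`;
it induces an algebra endomorphism of the exterior algebra `⋀ U`.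
-/

noncomputable section

/-! ### Abstract core -/

section core

variable {V : Type} [AddCommGroup V] [Module ℚ V]

/-- contraction -/
def cl (d : Module.Dual ℚ V) : ExteriorAlgebra ℚ V →ₗ[ℚ] ExteriorAlgebra ℚ V :=
  CliffordAlgebra.contractLeft (Q := (0 : QuadraticForm ℚ V)) d

/-- generators -/
def io (v : V) : ExteriorAlgebra ℚ V := ExteriorAlgebra.ι ℚ v

/-- augmentation -/
def ep : ExteriorAlgebra ℚ V →ₐ[ℚ] ℚ := ExteriorAlgebra.algebraMapInv

lemma cl_io_mul (d : Module.Dual ℚ V) (v : V) (x : ExteriorAlgebra ℚ V) :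
    cl d (io v * x) = d v • x - io v * cl d x :=
  CliffordAlgebra.contractLeft_ι_mul (Q := (0 : QuadraticForm ℚ V)) d v x

lemma cl_io (d : Module.Dual ℚ V) (v : V) : cl d (io v) = algebraMap ℚ _ (d v) :=
  CliffordAlgebra.contractLeft_ι (Q := (0 : QuadraticForm ℚ V)) d v

lemma cl_algebraMap (d : Module.Dual ℚ V) (r : ℚ) :
    cl d (algebraMap ℚ (ExteriorAlgebra ℚ V) r) = 0 :=
  CliffordAlgebra.contractLeft_algebraMap (Q := (0 : QuadraticForm ℚ V)) d r

lemma cl_one (d : Module.Dual ℚ V) : cl d (1 : ExteriorAlgebra ℚ V) = 0 :=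
  CliffordAlgebra.contractLeft_one (Q := (0 : QuadraticForm ℚ V)) d

lemma cl_cl (d : Module.Dual ℚ V) (x : ExteriorAlgebra ℚ V) : cl d (cl d x) = 0 :=
  CliffordAlgebra.contractLeft_contractLeft (Q := (0 : QuadraticForm ℚ V)) d x

lemma cl_comm (d e : Module.Dual ℚ V) (x : ExteriorAlgebra ℚ V) :
    cl d (cl e x) = - cl e (cl d x) :=
  CliffordAlgebra.contractLeft_comm (Q := (0 : QuadraticForm ℚ V)) d e x

lemma cl_add (d e : Module.Dual ℚ V) (x : ExteriorAlgebra ℚ V) :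
    cl (d + e) x = cl d x + cl e x := by simp [cl]

lemma cl_sub (d e : Module.Dual ℚ V) (x : ExteriorAlgebra ℚ V) :
    cl (d - e) x = cl d x - cl e x := by simp [cl]

lemma io_add (v w : V) : io (v + w) = io v + io w := by simp [io]
lemma io_sub (v w : V) : io (v - w) = io v - io w := by simp [io]
lemma io_smul (c : ℚ) (v : V) : io (c • v) = c • io v := by simp [io]

lemma io_sq (v : V) : io v * io v = 0 := ExteriorAlgebra.ι_sq_zero v

lemma io_sq_mul (v : V) (x : ExteriorAlgebra ℚ V) : io v * (io v * x) = 0 := by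
  rw [← mul_assoc, io_sq, zero_mul]

lemma io_swap (v w : V) : io v * io w = - (io w * io v) :=
  eq_neg_of_add_eq_zero_left (ExteriorAlgebra.ι_add_mul_swap v w)

lemma io_swap_mul (v w : V) (x : ExteriorAlgebra ℚ V) :
    io v * (io w * x) = - (io w * (io v * x)) := by
  rw [← mul_assoc, io_swap, neg_mul, mul_assoc]

lemma ep_io_mul (v : V) (x : ExteriorAlgebra ℚ V) : ep (io v * x) = 0 := by
  simp [ep, io, ExteriorAlgebra.algebraMapInv]

/-- key formula -/
lemma map_transv (T : V →ₗ[ℚ] V) (φ : Module.Dual ℚ V) (c : V)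
    (hT : ∀ v, T v = v + φ v • c) (x : ExteriorAlgebra ℚ V) :
    ExteriorAlgebra.map T x = x + io c * cl φ x := by
  induction x using CliffordAlgebra.left_induction with
  | algebraMap r =>
    have h1 := cl_algebraMap φ r
    have h2 := AlgHom.commutes (ExteriorAlgebra.map T) r
    exact h2.trans (by erw [h1]; simp)
  | add x y hx hy => rw [map_add, hx, hy, map_add, mul_add]; abel
  | ι_mul x v hx =>
    change ExteriorAlgebra.map T (io v * x) = io v * x + io c * cl φ (io v * x)
    have h1 : ExteriorAlgebra.map T (io v) = io (v + φ v • c) := by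
      rw [← hT]; exact ExteriorAlgebra.map_apply_ι T v
    rw [map_mul, hx, h1, cl_io_mul, io_add, io_smul, mul_sub, add_mul, mul_add, mul_add,
      smul_mul_assoc, smul_mul_assoc, io_sq_mul, io_swap_mul c v, mul_smul_comm]
    simp only [smul_zero]; abel

/-- commuting past a killed vector -/
lemma pres (d φ : Module.Dual ℚ V) (c : V) (x : ExteriorAlgebra ℚ V) (hd : d c = 0)
    (h : io c * cl φ x = 0) : io c * cl φ (cl d x) = 0 := by
  have := congrArg (cl d) h
  rw [cl_io_mul, hd, map_zero, zero_smul, zero_sub, neg_eq_zero] at this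
  rw [cl_comm, mul_neg, this, neg_zero]

lemma ann_cl (d : Module.Dual ℚ V) (c : V) (z : ExteriorAlgebra ℚ V) (hd : d c = 0)
    (h : io c * z = 0) : io c * cl d z = 0 := by
  have := congrArg (cl d) h
  rwa [cl_io_mul, hd, map_zero, zero_smul, zero_sub, neg_eq_zero] at this

lemma ann_eq (d : Module.Dual ℚ V) (c : V) (z : ExteriorAlgebra ℚ V)
    (h : io c * z = 0) : d c • z = io c * cl d z := by
  have := congrArg (cl d) h
  rwa [cl_io_mul, map_zero, sub_eq_zero] at this

/-- A partial symplectic system. -/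
structure Sys (V : Type) [AddCommGroup V] [Module ℚ V] (m : ℕ) where
  a : ℕ → V
  b : ℕ → V
  α : ℕ → Module.Dual ℚ V
  β : ℕ → Module.Dual ℚ V
  αa : ∀ i j, i < m → j < m → α i (a j) = if i = j then 1 else 0
  αb : ∀ i j, i < m → j < m → α i (b j) = 0
  βa : ∀ i j, i < m → j < m → β i (a j) = 0
  βb : ∀ i j, i < m → j < m → β i (b j) = if i = j then 1 else 0
  compl : ∀ x : ExteriorAlgebra ℚ V, (∀ j < m, cl (α j) x = 0 ∧ cl (β j) x = 0) →
    x = algebraMap ℚ _ (ep x)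

variable {m : ℕ} (S : Sys V m)

namespace Sys

/-- site operator -/
def O (s : Fin 3) (j : ℕ) : ExteriorAlgebra ℚ V →ₗ[ℚ] ExteriorAlgebra ℚ V :=
  match s with
  | 0 => LinearMap.id
  | 1 => cl (S.α j)
  | 2 => cl (S.β j) ∘ₗ cl (S.α j)

/-- ordered product of site operators -/
def F : List (Fin 3) → ℕ → (ExteriorAlgebra ℚ V →ₗ[ℚ] ExteriorAlgebra ℚ V)
  | [], _ => LinearMap.id
  | s :: l, k => S.O s k ∘ₗ F l (k + 1)

@[simp] lemma O0 (j : ℕ) (x : ExteriorAlgebra ℚ V) : S.O 0 j x = x := rfl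
@[simp] lemma O1 (j : ℕ) (x : ExteriorAlgebra ℚ V) : S.O 1 j x = cl (S.α j) x := rfl
@[simp] lemma O2 (j : ℕ) (x : ExteriorAlgebra ℚ V) :
    S.O 2 j x = cl (S.β j) (cl (S.α j) x) := rfl

@[simp] lemma F_nil (k : ℕ) (x : ExteriorAlgebra ℚ V) : S.F [] k x = x := rfl
@[simp] lemma F_cons (s : Fin 3) (l : List (Fin 3)) (k : ℕ) (x : ExteriorAlgebra ℚ V) :
    S.F (s :: l) k x = S.O s k (S.F l (k + 1) x) := rfl

lemma F_append (l l' : List (Fin 3)) (k : ℕ) (x : ExteriorAlgebra ℚ V) :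
    S.F (l ++ l') k x = S.F l k (S.F l' (k + l.length) x) := by
  induction l generalizing k with
  | nil => simp
  | cons s l ih =>
    simp only [List.cons_append, F_cons, ih, List.length_cons]
    congr 4; omega

lemma O_pres (s : Fin 3) (j : ℕ) (c : V) (φ : Module.Dual ℚ V) (x : ExteriorAlgebra ℚ V)
    (h1 : S.α j c = 0) (h2 : S.β j c = 0) (h : io c * cl φ x = 0) :
    io c * cl φ (S.O s j x) = 0 := by
  fin_cases s
  · exact h
  · exact pres _ _ _ _ h1 h
  · exact pres _ _ _ _ h2 (pres _ _ _ _ h1 h)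

lemma F_pres (l : List (Fin 3)) (k : ℕ) (c : V) (φ : Module.Dual ℚ V) (x : ExteriorAlgebra ℚ V)
    (hc : ∀ j, k ≤ j → j < k + l.length → S.α j c = 0 ∧ S.β j c = 0) (h : io c * cl φ x = 0) :
    io c * cl φ (S.F l k x) = 0 := by
  induction l generalizing k with
  | nil => exact h
  | cons s l ih =>
    rw [F_cons]
    have := hc k le_rfl (by simp)
    refine S.O_pres _ _ _ _ _ this.1 this.2 (ih (k + 1) fun j h1 h2 => hc j (by omega) ?_)
    simp only [List.length_cons]; omega

lemma O_fact (s : Fin 3) (j : ℕ) (c : V) (y : ExteriorAlgebra ℚ V)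
    (h1 : S.α j c = 0) (h2 : S.β j c = 0) :
    ∃ y', S.O s j (io c * y) = io c * y' := by
  fin_cases s
  · exact ⟨y, rfl⟩
  · exact ⟨- cl (S.α j) y, by simp [cl_io_mul, h1]⟩
  · exact ⟨cl (S.β j) (cl (S.α j) y), by simp [cl_io_mul, h1, h2]⟩

lemma F_fact (l : List (Fin 3)) (k : ℕ) (c : V) (y : ExteriorAlgebra ℚ V)
    (hc : ∀ j, k ≤ j → j < k + l.length → S.α j c = 0 ∧ S.β j c = 0) :
    ∃ y', S.F l k (io c * y) = io c * y' := by
  induction l generalizing k with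
  | nil => exact ⟨y, rfl⟩
  | cons s l ih =>
    obtain ⟨y', hy'⟩ := ih (k + 1) fun j h1 h2 => hc j (by omega) (by
      simp only [List.length_cons]; omega)
    rw [F_cons, hy']
    have := hc k le_rfl (by simp)
    exact S.O_fact _ _ _ _ this.1 this.2

/-- first family of equations -/
def K1 (x : ExteriorAlgebra ℚ V) : Prop := ∀ j < m, io (S.a j) * cl (S.β j) x = 0

/-- second family of equations -/
def K2 (x : ExteriorAlgebra ℚ V) : Prop := ∀ j, j + 1 < m →
  io (S.b (j + 1) - S.b j) * cl (S.α j - S.α (j + 1)) x = 0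

/-- nondegeneracy -/
lemma nondeg (k : ℕ) (hk : k ≤ m) (x : ExteriorAlgebra ℚ V) (h1 : S.K1 x)
    (h2 : ∀ j < m, k ≤ j → cl (S.α j) x = 0 ∧ cl (S.β j) x = 0)
    (h3 : ∀ l : List (Fin 3), l.length = k → ep (S.F l 0 x) = 0) : x = 0 := by
  induction k generalizing x with
  | zero =>
    rw [S.compl x fun j hj => h2 j hj (Nat.zero_le _)]
    have := h3 [] rfl
    rw [F_nil] at this
    rw [this, map_zero]
  | succ k ih =>
    have hkm : k < m := hk
    have hF : ∀ (s : Fin 3) (l : List (Fin 3)), l.length = k →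
        ep (S.F l 0 (S.O s k x)) = 0 := by
      intro s l hl
      have := h3 (l ++ [s]) (by simp [hl])
      rw [F_append] at this
      simpa [hl] using this
    have hβ : cl (S.β k) x = io (S.a k) * cl (S.α k) (cl (S.β k) x) := by
      have := ann_eq (S.α k) _ _ (h1 k hkm)
      rwa [S.αa k k hkm hkm, if_pos rfl, one_smul] at this
    -- K1 for the contracted elements
    have hKa : ∀ y, S.K1 y → cl (S.β k) y = 0 → S.K1 (cl (S.α k) y) := by
      intro y hy hy0 j hj
      by_cases hjk : j = k
      · subst hjk; rw [cl_comm, hy0]; simp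
      · exact pres _ _ _ _ (by rw [S.αa k j hkm hj, if_neg (Ne.symm hjk)]) (hy j hj)
    have hd : cl (S.β k) (cl (S.α k) x) = 0 := by
      apply ih hkm.le
      · intro j hj
        by_cases hjk : j = k
        · subst hjk; rw [cl_cl, mul_zero]
        · refine pres _ _ _ _ (S.βa k j hkm hj) (pres _ _ _ _ ?_ (h1 j hj))
          rw [S.αa k j hkm hj, if_neg (Ne.symm hjk)]
      · intro j hj hkj
        rcases hkj.eq_or_lt with rfl | hlt
        · refine ⟨?_, cl_cl _ _⟩
          rw [cl_comm, cl_cl]; simp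
        · obtain ⟨e1, e2⟩ := h2 j hj hlt
          constructor
          · rw [cl_comm, cl_comm (S.α j), e1]; simp
          · rw [cl_comm, cl_comm (S.β j), e2]; simp
      · intro l hl
        exact hF 2 l hl
    have hβ0 : cl (S.β k) x = 0 := by
      rw [hβ, cl_comm, hd]; simp
    have hα0 : cl (S.α k) x = 0 := by
      apply ih hkm.le
      · exact hKa x h1 hβ0
      · intro j hj hkj
        rcases hkj.eq_or_lt with rfl | hlt
        · exact ⟨cl_cl _ _, hd⟩
        · obtain ⟨e1, e2⟩ := h2 j hj hlt
          constructor
          · rw [cl_comm, e1]; simp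
          · rw [cl_comm, e2]; simp
      · intro l hl
        exact hF 1 l hl
    apply ih hkm.le x h1
    · intro j hj hkj
      rcases hkj.eq_or_lt with rfl | hlt
      · exact ⟨hα0, hβ0⟩
      · exact h2 j hj hlt
    · intro l hl
      exact hF 0 l hl

/-- local exchange relations -/
lemma local_swap (j : ℕ) (hj : j + 1 < m) (lam : ExteriorAlgebra ℚ V →ₗ[ℚ] ℚ)
    (ha : ∀ y, lam (io (S.a j) * y) = 0)
    (hb : ∀ y, lam (io (S.b (j + 1) - S.b j) * y) = 0)
    (ha' : ∀ y, lam (io (S.a (j + 1)) * y) = 0)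
    (x : ExteriorAlgebra ℚ V)
    (h1 : io (S.a j) * cl (S.β j) x = 0)
    (h1' : io (S.a (j + 1)) * cl (S.β (j + 1)) x = 0)
    (h2 : io (S.b (j + 1) - S.b j) * cl (S.α j - S.α (j + 1)) x = 0) :
    (∀ p q, lam (S.O p j (S.O q (j + 1) x)) = lam (S.O q j (S.O p (j + 1) x))) ∧
      lam (S.O 1 j (S.O 1 (j + 1) x)) = 0 := by
  have hjm : j < m := by omega
  have nz : S.β j (S.b (j + 1) - S.b j) = -1 := by
    rw [map_sub, S.βb j _ hjm hj, S.βb j j hjm hjm]; simp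
  have key : ∀ z, io (S.b (j + 1) - S.b j) * z = 0 → lam z = 0 := by
    intro z hz
    have := congrArg lam (ann_eq (S.β j) _ _ hz)
    rw [nz, hb, map_smul] at this
    simpa using this
  have e01 := key _ h2
  have kα : S.α j (S.b (j + 1) - S.b j) = 0 := by
    rw [map_sub, S.αb j _ hjm hj, S.αb j j hjm hjm, sub_zero]
  have kβ : (S.β j + S.β (j + 1)) (S.b (j + 1) - S.b j) = 0 := by
    simp [S.βb _ _ hjm hj, S.βb _ _ hjm hjm, S.βb _ _ hj hjm, S.βb _ _ hj hj]
  have z11 := ann_cl _ _ _ kα h2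
  have e11 := key _ z11
  have z02 := ann_cl _ _ _ kβ h2
  have e02 := key _ z02
  have e12 := key _ (ann_cl _ _ _ kα z02)
  have c1 : lam (cl (S.β j) (cl (S.α (j + 1)) x)) = 0 := by
    have := ann_eq (S.α j) _ _ h1
    rw [S.αa j j hjm hjm, if_pos rfl, one_smul] at this
    rw [cl_comm, this, cl_io_mul, S.αa _ _ hj hjm, if_neg (by omega), zero_smul, zero_sub,
      neg_neg, ha]
  have c2 : lam (cl (S.β (j + 1)) (cl (S.α j) x)) = 0 := by
    have := ann_eq (S.α (j + 1)) _ _ h1'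
    rw [S.αa _ _ hj hj, if_pos rfl, one_smul] at this
    rw [cl_comm, this, cl_io_mul, S.αa _ _ hjm hj, if_neg (by omega), zero_smul, zero_sub,
      neg_neg, ha']
  simp only [cl_sub, cl_add, map_sub, map_add, cl_cl, zero_sub, map_neg, neg_eq_zero] at e01 e11 e02 e12
  have f01 : lam (cl (S.α j) x) = lam (cl (S.α (j + 1)) x) := by linarith
  have f02 : lam (cl (S.β j) (cl (S.α j) x)) = lam (cl (S.β (j + 1)) (cl (S.α (j + 1)) x)) := by
    linarith
  have g1 : cl (S.α j) (cl (S.β j) (cl (S.α j) x)) = 0 := by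
    rw [cl_comm, cl_cl]; simp
  have g2 : cl (S.α j) (cl (S.β (j + 1)) (cl (S.α j) x)) = 0 := by
    rw [cl_comm, cl_cl]; simp
  have g3 : lam (cl (S.α j) (cl (S.β j) (cl (S.α (j + 1)) x))) =
      - lam (cl (S.β j) (cl (S.α j) (cl (S.α (j + 1)) x))) := by
    rw [cl_comm]; simp
  have f12 : lam (cl (S.α j) (cl (S.β (j + 1)) (cl (S.α (j + 1)) x))) =
      lam (cl (S.β j) (cl (S.α j) (cl (S.α (j + 1)) x))) := by
    rw [g1, g2, g3] at e12
    simp only [map_zero] at e12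
    linarith
  refine ⟨?_, e11⟩
  intro p q
  fin_cases p <;> fin_cases q <;>
    simp only [Fin.zero_eta, Fin.mk_one, Fin.reduceFinMk, O0, O1, O2] <;>
    first | rfl | linarith

lemma adj (x : ExteriorAlgebra ℚ V) (h1 : S.K1 x) (h2 : S.K2 x) (l l' : List (Fin 3))
    (hl : l.length + l'.length + 2 = m) :
    (∀ p q, ep (S.F (l ++ p :: q :: l') 0 x) = ep (S.F (l ++ q :: p :: l') 0 x)) ∧
      ep (S.F (l ++ 1 :: 1 :: l') 0 x) = 0 := by
  have hj : l.length + 1 < m := by omega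
  have hj' : l.length < m := by omega
  have van : ∀ i j, i < m → j < m → i ≠ j → (S.α i (S.a j) = 0 ∧ S.β i (S.a j) = 0) ∧
      (S.α i (S.b j) = 0 ∧ S.β i (S.b j) = 0) := by
    intro i j hi hj hij
    rw [S.αa i j hi hj, S.αb i j hi hj, S.βa i j hi hj, S.βb i j hi hj, if_neg hij]
    simp
  have vsub : ∀ i, i < m → i ≠ l.length → i ≠ l.length + 1 →
      S.α i (S.b (l.length + 1) - S.b l.length) = 0 ∧
      S.β i (S.b (l.length + 1) - S.b l.length) = 0 := by
    intro i hi h h'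
    obtain ⟨-, e1, e2⟩ := van i _ hi hj' h
    obtain ⟨-, e3, e4⟩ := van i _ hi hj h'
    rw [map_sub, map_sub, e1, e2, e3, e4]; simp
  have lamk : ∀ c, (∀ j < l.length, S.α j c = 0 ∧ S.β j c = 0) →
      ∀ y, (ep.toLinearMap ∘ₗ S.F l 0) (io c * y) = 0 := by
    intro c hc y
    obtain ⟨y', hy'⟩ := S.F_fact l 0 c y fun j _ h => hc j (by omega)
    simp [hy', ep_io_mul]
  have := S.local_swap l.length hj (ep.toLinearMap ∘ₗ S.F l 0)
    (lamk _ fun j h => (van j _ (by omega) hj' (by omega)).1)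
    (lamk _ fun j h => vsub j (by omega) (by omega) (by omega))
    (lamk _ fun j h => (van j _ (by omega) hj (by omega)).1)
    (S.F l' (l.length + 1 + 1) x)
    (S.F_pres _ _ _ _ _ (fun j h h' => (van j _ (by omega) hj' (by omega)).1) (h1 _ hj'))
    (S.F_pres _ _ _ _ _ (fun j h h' => (van j _ (by omega) hj (by omega)).1) (h1 _ hj))
    (S.F_pres _ _ _ _ _ (fun j h h' => vsub j (by omega) (by omega) (by omega)) (h2 _ hj))
  simpa [F_append] using this

lemma perm (x : ExteriorAlgebra ℚ V) (h1 : S.K1 x) (h2 : S.K2 x) (l l' : List (Fin 3))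
    (h : l.Perm l') (pre : List (Fin 3)) (hl : pre.length + l.length = m) :
    ep (S.F (pre ++ l) 0 x) = ep (S.F (pre ++ l') 0 x) := by
  induction h generalizing pre with
  | nil => rfl
  | cons a h ih =>
    have := ih (pre ++ [a]) (by simp at hl ⊢; omega)
    simpa using this
  | swap a b l => exact (S.adj x h1 h2 pre l (by simp at hl; omega)).1 _ _
  | trans h h' ih ih' => rw [ih pre hl, ih' pre (by rw [← h.length_eq]; exact hl)]

/-- the list of the `i`-th functional -/
def lst (m i : ℕ) : List (Fin 3) :=
  List.replicate (i % 2) 1 ++ (List.replicate (i / 2) 2 ++ List.replicate (m - i / 2 - i % 2) 0)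

lemma inj (x : ExteriorAlgebra ℚ V) (h1 : S.K1 x) (h2 : S.K2 x)
    (h : ∀ i < 2 * m + 1, ep (S.F (lst m i) 0 x) = 0) : x = 0 := by
  apply S.nondeg m le_rfl x h1 (fun j h h' => by omega)
  intro l hl
  have hp : l.Perm (List.replicate (l.count 1) 1 ++ (List.replicate (l.count 2) 2 ++
      List.replicate (l.count 0) 0)) := by
    rw [List.perm_iff_count]
    intro a
    fin_cases a <;> simp [List.count_replicate]
  have hlen := hp.length_eq
  simp only [List.length_append, List.length_replicate] at hlen
  have hh := S.perm x h1 h2 _ _ hp [] (by simpa using hl)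
  simp only [List.nil_append] at hh
  rw [hh]
  generalize l.count 1 = p at *
  generalize l.count 2 = q at *
  generalize l.count 0 = r at *
  by_cases hp2 : p < 2
  · have := h (2 * q + p) (by omega)
    have e1 : (2 * q + p) % 2 = p := by omega
    have e2 : (2 * q + p) / 2 = q := by omega
    have e3 : m - q - p = r := by omega
    rwa [lst, e1, e2, e3] at this
  · obtain ⟨p, rfl⟩ : ∃ p', p = p' + 2 := ⟨p - 2, by omega⟩
    have := (S.adj x h1 h2 [] (List.replicate p 1 ++ (List.replicate q 2 ++ List.replicate r 0))
      (by simp only [List.length_append, List.length_replicate, List.length_nil]; omega)).2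
    rw [List.replicate_succ, List.replicate_succ, List.cons_append, List.cons_append]
    rw [List.nil_append] at this
    exact this

end Sys

end core

section low

variable {V : Type} [AddCommGroup V] [Module ℚ V] {m : ℕ} (S : Sys V m)

namespace Sys

/-- the bivector of a site -/
def w (j : ℕ) : ExteriorAlgebra ℚ V := io (S.a j) * io (S.b j)

/-- partial symplectic form -/
def om : ℕ → ExteriorAlgebra ℚ V
  | 0 => 0
  | k + 1 => om k + S.w k

/-- partial radical vector -/
def rv : ℕ → V
  | 0 => 0
  | k + 1 => rv k + S.a k

lemma io_w (v : V) (j : ℕ) : io v * S.w j = S.w j * io v := by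
  unfold w
  rw [io_swap_mul, io_swap v, mul_neg, neg_neg, mul_assoc]

lemma io_om (v : V) (k : ℕ) : io v * S.om k = S.om k * io v := by
  induction k with
  | zero => simp [om]
  | succ k ih => simp only [om, mul_add, add_mul, ih, io_w]

lemma w_om (j k : ℕ) : Commute (S.w j) (S.om k) := by
  unfold w
  exact Commute.mul_left (S.io_om _ k) (S.io_om _ k)

lemma w_sq (j : ℕ) : S.w j * S.w j = 0 := by
  have h : S.w j * S.w j = io (S.a j) * (io (S.b j) * S.w j) := by
    conv_lhs => rw [w, mul_assoc]
    rfl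
  rw [h, io_w, w, mul_assoc, io_sq, mul_zero, mul_zero]

lemma cl_w_mul (d : Module.Dual ℚ V) (j : ℕ) (h1 : d (S.a j) = 0) (h2 : d (S.b j) = 0)
    (y : ExteriorAlgebra ℚ V) : cl d (S.w j * y) = S.w j * cl d y := by
  simp [w, mul_assoc, cl_io_mul, h1, h2]

lemma cl_om_mul (d : Module.Dual ℚ V) (k : ℕ) (h : ∀ j < k, d (S.a j) = 0 ∧ d (S.b j) = 0)
    (y : ExteriorAlgebra ℚ V) : cl d (S.om k * y) = S.om k * cl d y := by
  induction k with
  | zero => simp [om]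
  | succ k ih =>
    have := h k (by omega)
    rw [om, add_mul, map_add, ih (fun j hj => h j (by omega)), S.cl_w_mul d k this.1 this.2,
      add_mul]

lemma cl_om_pow_mul (d : Module.Dual ℚ V) (k n : ℕ)
    (h : ∀ j < k, d (S.a j) = 0 ∧ d (S.b j) = 0)
    (y : ExteriorAlgebra ℚ V) : cl d (S.om k ^ n * y) = S.om k ^ n * cl d y := by
  induction n with
  | zero => simp
  | succ n ih => rw [pow_succ', mul_assoc, S.cl_om_mul d k h, ih, mul_assoc]

lemma d_rv (d : Module.Dual ℚ V) (k : ℕ) (h : ∀ j < k, d (S.a j) = 0) : d (S.rv k) = 0 := by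
  induction k with
  | zero => simp [rv]
  | succ k ih => rw [rv, map_add, ih (fun j hj => h j (by omega)), h k (by omega), add_zero]

lemma om_succ_pow (k n : ℕ) :
    S.om (k + 1) ^ (n + 1) = S.om k ^ (n + 1) + (n + 1 : ℚ) • (S.om k ^ n * S.w k) := by
  induction n with
  | zero => simp [om]
  | succ n ih =>
    have hc := (S.w_om k k).eq
    have e1 : S.om k ^ n * S.w k * S.om k = S.om k ^ (n + 1) * S.w k := by
      rw [mul_assoc, hc, ← mul_assoc, pow_succ]
    have e2 : S.om k ^ n * S.w k * S.w k = 0 := by rw [mul_assoc, w_sq, mul_zero]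
    rw [pow_succ, ih, om, add_mul, mul_add, mul_add, smul_mul_assoc, smul_mul_assoc, e1, e2,
      ← pow_succ]
    push_cast
    module

lemma L_w (k : ℕ) (hk : k < m) : S.O 2 k (S.w k) = 1 := by
  simp [w, cl_io_mul, cl_io, S.αa k k hk hk, S.αb k k hk hk, S.βa k k hk hk, S.βb k k hk hk]

lemma van (k : ℕ) (hk : k < m) : (∀ j < k, S.α k (S.a j) = 0 ∧ S.α k (S.b j) = 0) ∧
    (∀ j < k, S.β k (S.a j) = 0 ∧ S.β k (S.b j) = 0) := by
  constructor <;> intro j hj <;>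
  simp [S.αa k j hk (by omega), S.αb k j hk (by omega), S.βa k j hk (by omega),
    S.βb k j hk (by omega)] <;> omega

lemma L_om (k n : ℕ) (hk : k < m) (y : ExteriorAlgebra ℚ V) :
    S.O 2 k (S.om k ^ n * y) = S.om k ^ n * S.O 2 k y := by
  obtain ⟨h1, h2⟩ := S.van k hk
  rw [O2, O2, S.cl_om_pow_mul _ _ _ h1, S.cl_om_pow_mul _ _ _ h2]

lemma L_one (k : ℕ) : S.O 2 k (1 : ExteriorAlgebra ℚ V) = 0 := by
  rw [O2, cl_one, map_zero]

lemma L_om_succ (k n : ℕ) (hk : k < m) :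
    S.O 2 k (S.om (k + 1) ^ (n + 1)) = (n + 1 : ℚ) • S.om k ^ n := by
  have h0 := S.L_om k (n + 1) hk 1
  rw [L_one, mul_one, mul_zero] at h0
  rw [om_succ_pow, map_add, h0, map_smul, S.L_om _ _ hk, S.L_w k hk, mul_one, zero_add]

lemma om_ne (k : ℕ) (hk : k ≤ m) : S.om k ^ k ≠ 0 := by
  induction k with
  | zero => simp
  | succ k ih =>
    intro h
    have := S.L_om_succ k k hk
    rw [h, map_zero] at this
    have h3 : (k + 1 : ℚ) ≠ 0 := by positivity
    exact ih (by omega) ((smul_eq_zero.mp this.symm).resolve_left h3)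

lemma L_rv (k n : ℕ) (hk : k < m) :
    S.O 2 k (io (S.rv (k + 1)) * S.om (k + 1) ^ (n + 1)) =
      (n + 1 : ℚ) • (io (S.rv k) * S.om k ^ n) := by
  obtain ⟨h1, h2⟩ := S.van k hk
  have r1 := S.d_rv (S.α k) k fun j hj => (h1 j hj).1
  have r2 := S.d_rv (S.β k) k fun j hj => (h2 j hj).1
  have hL : ∀ y, S.O 2 k (io (S.rv k) * y) = io (S.rv k) * S.O 2 k y := by
    intro y; simp [cl_io_mul, r1, r2]
  have hc : ∀ n, io (S.a k) * S.om k ^ n = S.om k ^ n * io (S.a k) := fun n =>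
    (Commute.pow_right (show Commute (io (S.a k)) (S.om k) from S.io_om _ k) n).eq
  have hz : io (S.a k) * (S.om k ^ n * S.w k) = 0 := by
    rw [← mul_assoc, hc, mul_assoc, w, io_sq_mul, mul_zero]
  have hz2 : S.O 2 k (io (S.a k)) = 0 := by rw [O2, cl_io, cl_algebraMap]
  rw [rv, io_add, add_mul, map_add, hL, S.L_om_succ _ _ hk, om_succ_pow, mul_add, mul_smul_comm,
    mul_smul_comm, hz, hc, smul_zero, add_zero, S.L_om _ _ hk, hz2, mul_zero, add_zero]

lemma rv_ne (k : ℕ) (hk : k < m) : io (S.rv (k + 1)) * S.om (k + 1) ^ k ≠ 0 := by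
  induction k with
  | zero =>
    intro h
    have := congrArg (cl (S.α 0)) h
    simp [rv, cl_io, S.αa 0 0 hk hk] at this
  | succ k ih =>
    intro h
    have := S.L_rv (k + 1) k hk
    rw [h, map_zero] at this
    have h3 : (k + 1 : ℚ) ≠ 0 := by positivity
    exact ih (by omega) ((smul_eq_zero.mp this.symm).resolve_left h3)

/-- the invariants -/
def fam (i : ℕ) : ExteriorAlgebra ℚ V := io (S.rv m) ^ (i % 2) * S.om m ^ (i / 2)

lemma fam_ne (i : ℕ) (hi : i < 2 * m + 1) : S.fam i ≠ 0 := by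
  unfold fam
  rcases Nat.mod_two_eq_zero_or_one i with h | h
  · rw [h, pow_zero, one_mul]
    intro h0
    exact S.om_ne m le_rfl (pow_eq_zero_of_le (by omega) h0)
  · rw [h, pow_one]
    intro h0
    obtain ⟨k, rfl⟩ : ∃ k, m = k + 1 := ⟨m - 1, by omega⟩
    apply S.rv_ne k (by omega)
    have : S.om (k + 1) ^ k = S.om (k + 1) ^ (i / 2) * S.om (k + 1) ^ (k - i / 2) := by
      rw [← pow_add]; congr 1; omega
    rw [this, ← mul_assoc, h0, zero_mul]

/-- scaling -/
def sc : ExteriorAlgebra ℚ V →ₐ[ℚ] ExteriorAlgebra ℚ V :=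
  ExteriorAlgebra.map ((2 : ℚ) • LinearMap.id)

lemma sc_io (v : V) : sc (io v) = (2 : ℚ) • io v := by
  rw [← io_smul]; exact ExteriorAlgebra.map_apply_ι _ v

lemma sc_om (k : ℕ) : sc (S.om k) = (4 : ℚ) • S.om k := by
  induction k with
  | zero => simp [om]
  | succ k ih =>
    rw [om, map_add, ih, w, map_mul, sc_io, sc_io, smul_add]
    rw [smul_mul_smul_comm]; norm_num

lemma sc_fam (i : ℕ) : sc (S.fam i) = (2 : ℚ) ^ i • S.fam i := by
  unfold fam
  rw [map_mul, map_pow, map_pow, sc_io, sc_om, smul_pow, smul_pow, smul_mul_smul_comm]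
  congr 1
  rw [show (4 : ℚ) = 2 ^ 2 by norm_num, ← pow_mul, ← pow_add]
  congr 1; omega

lemma fam_li : LinearIndependent ℚ (fun i : Fin (2 * m + 1) => S.fam i) := by
  apply Module.End.eigenvectors_linearIndependent' (sc (V := V)).toLinearMap
    (fun i : Fin (2 * m + 1) => (2 : ℚ) ^ (i : ℕ))
  · intro i j h
    exact Fin.ext (pow_right_injective₀ (by norm_num) (by norm_num) h)
  · intro i
    exact ⟨Module.End.mem_eigenspace_iff.mpr (S.sc_fam i), S.fam_ne i i.2⟩

lemma cl_om (d : Module.Dual ℚ V) (k : ℕ) : cl d (S.om k) =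
    ∑ j ∈ Finset.range k, (d (S.a j) • io (S.b j) - d (S.b j) • io (S.a j)) := by
  induction k with
  | zero => simp [om]
  | succ k ih =>
    rw [om, map_add, ih, Finset.sum_range_succ, w, cl_io_mul, cl_io]
    rw [Algebra.algebraMap_eq_smul_one, mul_smul_comm, mul_one]

lemma rv_eq (k : ℕ) : S.rv k = ∑ j ∈ Finset.range k, S.a j := by
  induction k with
  | zero => simp [rv]
  | succ k ih => rw [rv, ih, Finset.sum_range_succ]

lemma α_rv (j : ℕ) (hj : j < m) : S.α j (S.rv m) = 1 := by
  rw [rv_eq, map_sum, Finset.sum_congr rfl fun i hi => S.αa j i hj (Finset.mem_range.mp hi)]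
  simp [hj]

lemma β_rv (j : ℕ) (hj : j < m) : S.β j (S.rv m) = 0 := by
  rw [rv_eq, map_sum, Finset.sum_congr rfl fun i hi => S.βa j i hj (Finset.mem_range.mp hi)]
  simp

lemma α_om (j : ℕ) (hj : j < m) : cl (S.α j) (S.om m) = io (S.b j) := by
  rw [cl_om, Finset.sum_congr rfl fun i hi => by
    rw [S.αa j i hj (Finset.mem_range.mp hi), S.αb j i hj (Finset.mem_range.mp hi)]]
  simp [hj]

lemma β_om (j : ℕ) (hj : j < m) : cl (S.β j) (S.om m) = - io (S.a j) := by
  rw [cl_om, Finset.sum_congr rfl fun i hi => by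
    rw [S.βa j i hj (Finset.mem_range.mp hi), S.βb j i hj (Finset.mem_range.mp hi)]]
  simp [hj]

lemma fam_fix (f : ExteriorAlgebra ℚ V →ₐ[ℚ] ExteriorAlgebra ℚ V)
    (h1 : f (io (S.rv m)) = io (S.rv m)) (h2 : f (S.om m) = S.om m) (i : ℕ) :
    f (S.fam i) = S.fam i := by
  rw [fam, map_mul, map_pow, map_pow, h1, h2]

/-- dimension count -/
theorem dim (W : Submodule ℚ (ExteriorAlgebra ℚ V))
    (hW : ∀ x, x ∈ W ↔ S.K1 x ∧ S.K2 x) : Module.finrank ℚ W = 2 * m + 1 := by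
  let Φ : W →ₗ[ℚ] (Fin (2 * m + 1) → ℚ) :=
    LinearMap.pi fun i => ep.toLinearMap ∘ₗ S.F (lst m i) 0 ∘ₗ W.subtype
  have hΦ : Function.Injective Φ := by
    rw [← LinearMap.ker_eq_bot, LinearMap.ker_eq_bot']
    rintro ⟨x, hx⟩ h
    obtain ⟨k1, k2⟩ := (hW x).1 hx
    have : x = 0 := S.inj x k1 k2 fun i hi => congrFun h ⟨i, hi⟩
    exact Subtype.ext this
  have : FiniteDimensional ℚ W := FiniteDimensional.of_injective Φ hΦ
  apply le_antisymm
  · simpa using LinearMap.finrank_le_finrank_of_injective hΦ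
  · have hmem : ∀ i, S.fam i ∈ W := by
      intro i
      rw [hW]
      constructor
      · intro j hj
        have hf := map_transv (LinearMap.id + (S.β j).smulRight (S.a j)) (S.β j) (S.a j)
          (fun v => by simp)
        have := S.fam_fix (ExteriorAlgebra.map (LinearMap.id + (S.β j).smulRight (S.a j)))
          (by rw [hf, cl_io, S.β_rv j hj]; simp)
          (by rw [hf, S.β_om j hj, mul_neg, io_sq]; simp) i
        rw [hf] at this
        simpa using this
      · intro j hj
        have hj' : j < m := by omega
        have hf := map_transv (LinearMap.id +
          (S.α j - S.α (j + 1)).smulRight (S.b (j + 1) - S.b j))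
          (S.α j - S.α (j + 1)) (S.b (j + 1) - S.b j) (fun v => by simp)
        have := S.fam_fix (ExteriorAlgebra.map (LinearMap.id +
          (S.α j - S.α (j + 1)).smulRight (S.b (j + 1) - S.b j)))
          (by rw [hf, cl_io, LinearMap.sub_apply, S.α_rv j hj', S.α_rv _ hj]; simp)
          (by
            rw [hf, cl_sub, S.α_om j hj', S.α_om _ hj, ← io_sub,
              ← neg_sub (S.b (j + 1)) (S.b j), ← neg_one_smul ℚ (S.b (j + 1) - S.b j), io_smul,
              mul_smul_comm, io_sq]
            simp) i
        rw [hf] at this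
        simpa using this
    have hli : LinearIndependent ℚ (fun i : Fin (2 * m + 1) => (⟨S.fam i, hmem i⟩ : W)) :=
      LinearIndependent.of_comp W.subtype S.fam_li
    simpa using hli.fintype_card_le_finrank

end Sys

end low

section concrete

/-- coordinate functional -/
def ent (n i : ℕ) : Module.Dual ℚ (Fin n → ℚ) where
  toFun x := entry n x i
  map_add' x y := entry_add n x y i
  map_smul' c x := entry_smul n c x i

lemma ent_bas (n i j : ℕ) (hi : 1 ≤ i) (hi' : i ≤ n) :
    ent n i (bas n j) = if i = j then 1 else 0 := by
  change entry n (bas n j) i = _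
  unfold entry bas
  rw [dif_pos ⟨hi, hi'⟩]
  simp only
  congr 1
  rw [Nat.sub_add_cancel hi]

lemma ent_out (n i : ℕ) (hi : n < i) : ent n i = 0 := by
  ext x
  change entry n _ i = _
  unfold entry
  rw [dif_neg (by omega)]; simp

/-- truncation -/
def tr (n k : ℕ) : (Fin n → ℚ) →ₗ[ℚ] (Fin n → ℚ) where
  toFun x i := if (i : ℕ) < k then 0 else x i
  map_add' x y := by ext i; simp only [Pi.add_apply]; split <;> simp
  map_smul' c x := by ext i; simp

lemma compl_aux (n : ℕ) (x : ExteriorAlgebra ℚ (Fin n → ℚ))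
    (h : ∀ i, 1 ≤ i → i ≤ n → cl (ent n i) x = 0) : x = algebraMap ℚ _ (ep x) := by
  have key : ∀ k, k ≤ n → ExteriorAlgebra.map (tr n k) x = x := by
    intro k
    induction k with
    | zero =>
      intro _
      have : tr n 0 = LinearMap.id := by ext; simp [tr]
      rw [this, ExteriorAlgebra.map_id]; rfl
    | succ k ih =>
      intro hk
      have hf := map_transv (LinearMap.id + (ent n (k + 1)).smulRight (- bas n (k + 1)))
        (ent n (k + 1)) (- bas n (k + 1)) (fun v => by simp) x
      have : tr n (k + 1) =
          tr n k ∘ₗ (LinearMap.id + (ent n (k + 1)).smulRight (- bas n (k + 1))) := by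
        apply LinearMap.ext
        intro v
        ext i
        simp only [tr, LinearMap.coe_mk, AddHom.coe_mk, LinearMap.comp_apply, LinearMap.add_apply,
          LinearMap.id_apply, LinearMap.smulRight_apply, Pi.add_apply, Pi.smul_apply, Pi.neg_apply,
          bas, ent, entry]
        rw [dif_pos (by omega)]
        rcases lt_trichotomy (i : ℕ) k with h | h | h
        · rw [if_pos (by omega), if_pos h]
        · have : (⟨k + 1 - 1, by omega⟩ : Fin n) = i := Fin.ext (by simp [h])
          rw [if_pos (by omega), if_neg (by omega), if_pos (by omega), this]; simp
        · rw [if_neg (by omega), if_neg (by omega), if_neg (by omega)]; simp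
      rw [this, ← ExteriorAlgebra.map_comp_map, AlgHom.comp_apply, hf, h _ (by omega) hk,
        mul_zero, add_zero, ih (by omega)]
  have h0 : tr n n = 0 := by
    apply LinearMap.ext
    intro v; ext i
    simp [tr]
  have := key n le_rfl
  rw [h0] at this
  have hh : ExteriorAlgebra.map (0 : (Fin n → ℚ) →ₗ[ℚ] (Fin n → ℚ)) =
      (Algebra.ofId ℚ _).comp ep := by
    apply ExteriorAlgebra.hom_ext
    ext v
    simp [ep, ExteriorAlgebra.algebraMapInv]
  rw [hh] at this
  exact this.symm

/-- the `b` vectors -/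
def bv (n : ℕ) : ℕ → (Fin n → ℚ)
  | 0 => bas n 1
  | k + 1 => bv n k + bas n (2 * k + 3)

lemma ent_even_bv (n i k : ℕ) (h : 2 * i + 2 ≤ n) : ent n (2 * i + 2) (bv n k) = 0 := by
  induction k with
  | zero => rw [bv, ent_bas _ _ _ (by omega) h, if_neg (by omega)]
  | succ k ih => rw [bv, map_add, ih, ent_bas _ _ _ (by omega) h, if_neg (by omega), add_zero]

lemma ent_odd_bv (n i k : ℕ) (h : 2 * i + 1 ≤ n) :
    ent n (2 * i + 1) (bv n k) = if i ≤ k then 1 else 0 := by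
  induction k with
  | zero =>
    rw [bv, ent_bas _ _ _ (by omega) h]
    by_cases hi : i = 0
    · simp [hi]
    · rw [if_neg (by omega), if_neg (by omega)]
  | succ k ih =>
    rw [bv, map_add, ih, ent_bas _ _ _ (by omega) h]
    rcases lt_trichotomy i (k + 1) with hi | hi | hi
    · rw [if_pos (by omega), if_neg (by omega), if_pos (by omega), add_zero]
    · rw [if_neg (by omega), if_pos (by omega), if_pos (by omega), zero_add]
    · rw [if_neg (by omega), if_neg (by omega), if_neg (by omega), zero_add]

/-- the concrete system -/
def sys (m : ℕ) : Sys (Fin (2 * m) → ℚ) m where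
  a j := bas (2 * m) (2 * j + 2)
  b j := bv (2 * m) j
  α j := ent (2 * m) (2 * j + 2)
  β j := ent (2 * m) (2 * j + 1) - ent (2 * m) (2 * j + 3)
  αa i j hi hj := by
    rw [ent_bas _ _ _ (by omega) (by omega)]
    congr 1
    simp
  αb i j hi hj := ent_even_bv _ _ _ (by omega)
  βa i j hi hj := by
    rw [LinearMap.sub_apply, ent_bas _ _ _ (by omega) (by omega), if_neg (by omega)]
    by_cases h : i + 1 < m
    · rw [ent_bas _ _ _ (by omega) (by omega), if_neg (by omega), sub_zero]
    · rw [ent_out _ _ (by omega)]; simp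
  βb i j hi hj := by
    rw [LinearMap.sub_apply, ent_odd_bv _ _ _ (by omega)]
    by_cases h : i + 1 < m
    · have := ent_odd_bv (2 * m) (i + 1) j (by omega)
      rw [show 2 * (i + 1) + 1 = 2 * i + 3 by ring] at this
      rw [this]
      rcases lt_trichotomy i j with h | h | h
      · rw [if_pos (by omega), if_pos (by omega), if_neg (by omega), sub_self]
      · rw [if_pos (by omega), if_neg (by omega), if_pos (by omega), sub_zero]
      · rw [if_neg (by omega), if_neg (by omega), if_neg (by omega), sub_self]
    · rw [ent_out _ _ (by omega), LinearMap.zero_apply, sub_zero]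
      by_cases h : i = j
      · rw [if_pos (by omega), if_pos h]
      · rw [if_neg (by omega), if_neg h]
  compl x hx := by
    apply compl_aux
    have hodd : ∀ k, k ≤ m → cl (ent (2 * m) (2 * (m - k) + 1)) x = 0 := by
      intro k
      induction k with
      | zero => intro _; rw [ent_out _ _ (by omega)]; simp [cl]
      | succ k ih =>
        intro hk
        have h1 := (hx (m - (k + 1)) (by omega)).2
        rw [cl_sub, show 2 * (m - (k + 1)) + 3 = 2 * (m - k) + 1 by omega, ih (by omega),
          sub_zero] at h1
        exact h1
    intro i hi hi'
    rcases Nat.even_or_odd' i with ⟨j, rfl | rfl⟩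
    · have := (hx (j - 1) (by omega)).1
      rwa [show 2 * (j - 1) + 2 = 2 * j by omega] at this
    · have := hodd (m - j) (by omega)
      rwa [show m - (m - j) = j by omega] at this

lemma extT_even (m j : ℕ) (x : ExteriorAlgebra ℚ (Fin (2 * m) → ℚ)) :
    extT (2 * m) (2 * j + 2) x = x + io ((sys m).a j) * cl ((sys m).β j) x :=
  map_transv _ _ _ (fun _ => rfl) x

lemma extT_odd (m j : ℕ) (x : ExteriorAlgebra ℚ (Fin (2 * m) → ℚ)) :
    extT (2 * m) (2 * j + 3) x = x + io ((sys m).b (j + 1) - (sys m).b j) *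
      cl ((sys m).α j - (sys m).α (j + 1)) x := by
  apply map_transv
  intro v
  have : (sys m).b (j + 1) - (sys m).b j = bas (2 * m) (2 * j + 3) := by
    change bv _ j + _ - bv _ j = _
    abel
  rw [this]
  rfl

end concrete

/-- Lemma 4.3.3, case 2: for `I' = {2, 3, …, 2m}`, the space of `T_{I'}`-invariants in
`⋀ U` has dimension `2m + 1`. -/
theorem invariants_dim_case2 (m : ℕ) (hm : 1 ≤ m) :
    Module.finrank ℚ (invSub (2 * m) {i | 2 ≤ i ∧ i ≤ 2 * m}) = 2 * m + 1 := by
  apply (sys m).dim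
  intro x
  have hmem : x ∈ invSub (2 * m) {i | 2 ≤ i ∧ i ≤ 2 * m} ↔
      ∀ i, 2 ≤ i ∧ i ≤ 2 * m → extT (2 * m) i x = x := by
    simp only [invSub, Submodule.mem_iInf, LinearMap.mem_eqLocus]
    rfl
  rw [hmem]
  constructor
  · intro h
    constructor
    · intro j hj
      have := h (2 * j + 2) ⟨by omega, by omega⟩
      rw [extT_even] at this
      simpa using this
    · intro j hj
      have := h (2 * j + 3) ⟨by omega, by omega⟩
      rw [extT_odd] at this
      simpa using this
  · rintro ⟨h1, h2⟩ i ⟨hi, hi'⟩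
    rcases Nat.even_or_odd' i with ⟨j, rfl | rfl⟩
    · obtain ⟨j, rfl⟩ : ∃ k, j = k + 1 := ⟨j - 1, by omega⟩
      rw [show 2 * (j + 1) = 2 * j + 2 by ring, extT_even, h1 j (by omega), add_zero]
    · obtain ⟨j, rfl⟩ : ∃ k, j = k + 1 := ⟨j - 1, by omega⟩
      rw [show 2 * (j + 1) + 1 = 2 * j + 3 by ring, extT_odd, h2 j (by omega), add_zero]

end
end

section
/- Let t be an odd integer with 1 ≤ t ≤ 2m − 1. The subspace of the exterior algebra ⋀U consisting of elements fixed by T_i for every i in I'' = {2, …, t} ∪ {t + 2, …, 2m} has dimension (t + 1)(2m − t + 1) over ℚ. (Lemma 4.3.3, case 3.) -/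
/-!
Setup: `U = ℚ^{2m}` with basis `c_1, …, c_{2m}` (1-based indexing).
`T i` is the linear automorphism with `T i (c_j) = c_j` for `|i - j| ≠ 1`,
`T i (c_{i+1}) = c_{i+1} - c_i`, `T i (c_{i-1}) = c_{i-1} + c_i`;
it induces an algebra endomorphism of the exterior algebra `⋀ U`.
-/

noncomputable section

namespace Fock

abbrev Idx (m : ℕ) := Fin m × Bool

def key {m : ℕ} (i : Idx m) : ℕ := 2 * i.1.val + (if i.2 then 1 else 0)

lemma key_inj {m : ℕ} {i j : Idx m} (h : key i = key j) : i = j := by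
  obtain ⟨a, b⟩ := i
  obtain ⟨c, d⟩ := j
  cases b <;> cases d <;> simp [key, Fin.ext_iff] at h ⊢ <;> omega

def sg {m : ℕ} (i : Idx m) (S : Finset (Idx m)) : ℚ :=
  ∏ j ∈ S, if key j < key i then -1 else 1

lemma sg_insert {m : ℕ} (i j : Idx m) (S : Finset (Idx m)) (h : j ∉ S) :
    sg i (insert j S) = (if key j < key i then -1 else 1) * sg i S := by
  simp [sg, Finset.prod_insert h]

lemma sg_erase {m : ℕ} (i j : Idx m) (S : Finset (Idx m)) (h : j ∈ S) :
    sg i (S.erase j) = (if key j < key i then -1 else 1) * sg i S := by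
  conv_rhs => rw [← Finset.insert_erase h, sg_insert _ _ _ (Finset.notMem_erase j S)]
  split_ifs <;> ring

lemma sg_sq {m : ℕ} (i : Idx m) (S : Finset (Idx m)) : sg i S * sg i S = 1 := by
  unfold sg
  rw [← Finset.prod_mul_distrib]
  apply Finset.prod_eq_one
  intro j _
  split_ifs <;> norm_num

lemma sg_ne {m : ℕ} (i : Idx m) (S : Finset (Idx m)) : sg i S ≠ 0 := by
  intro h
  have := sg_sq i S
  rw [h] at this
  norm_num at this

abbrev M (m : ℕ) := Finset (Idx m) → ℚ

def L {m : ℕ} (i : Idx m) : M m →ₗ[ℚ] M m where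
  toFun f S := if i ∈ S then sg i S * f (S.erase i) else 0
  map_add' f g := by ext S; simp only [Pi.add_apply]; split_ifs <;> ring
  map_smul' c f := by
    ext S; simp only [Pi.smul_apply, smul_eq_mul, RingHom.id_apply]; split_ifs <;> ring

def D {m : ℕ} (i : Idx m) : M m →ₗ[ℚ] M m where
  toFun f S := if i ∈ S then 0 else sg i S * f (insert i S)
  map_add' f g := by ext S; simp only [Pi.add_apply]; split_ifs <;> ring
  map_smul' c f := by
    ext S; simp only [Pi.smul_apply, smul_eq_mul, RingHom.id_apply]; split_ifs <;> ring

lemma L_apply {m : ℕ} (i : Idx m) (f : M m) (S : Finset (Idx m)) :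
    L i f S = if i ∈ S then sg i S * f (S.erase i) else 0 := rfl

lemma D_apply {m : ℕ} (i : Idx m) (f : M m) (S : Finset (Idx m)) :
    D i f S = if i ∈ S then 0 else sg i S * f (insert i S) := rfl

lemma LL {m : ℕ} (i j : Idx m) : L i * L j + L j * L i = 0 := by
  refine LinearMap.ext fun f => funext fun S => ?_
  simp only [LinearMap.add_apply, Module.End.mul_apply, LinearMap.zero_apply, Pi.add_apply,
    Pi.zero_apply, L_apply, Finset.mem_erase]
  by_cases hij : i = j
  · subst hij; simp
  · by_cases hi : i ∈ S <;> by_cases hj : j ∈ S <;>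
      simp only [hi, hj, hij, Ne.symm hij, ne_eq, not_false_eq_true, and_true, and_false,
        if_true, if_false, mul_zero, add_zero]
    rw [sg_erase _ _ _ hi, sg_erase _ _ _ hj, Finset.erase_right_comm]
    have : key i ≠ key j := fun h => hij (key_inj h)
    rcases lt_or_gt_of_ne this with h | h
    · simp [h, h.not_gt]; ring
    · simp [h, h.not_gt]; ring

lemma DL {m : ℕ} (i j : Idx m) : D i * L j + L j * D i = if i = j then 1 else 0 := by
  refine LinearMap.ext fun f => funext fun S => ?_
  simp only [LinearMap.add_apply, Module.End.mul_apply, Pi.add_apply, L_apply, D_apply,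
    Finset.mem_erase, Finset.mem_insert]
  by_cases hij : i = j
  · subst hij
    by_cases hi : i ∈ S
    · simp [hi, sg_erase, Finset.insert_erase hi, ← mul_assoc, sg_sq]
    · simp [hi, sg_insert, Finset.erase_insert hi, ← mul_assoc, sg_sq]
  · by_cases hi : i ∈ S <;> by_cases hj : j ∈ S <;>
      simp only [hi, hj, hij, Ne.symm hij, ne_eq, not_false_eq_true, and_true, and_false,
        if_true, if_false, mul_zero, add_zero, false_or, or_false, or_true,
        LinearMap.zero_apply, Pi.zero_apply]
    rw [sg_insert _ _ _ hi, sg_erase _ _ _ hj, Finset.erase_insert_of_ne hij]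
    have : key i ≠ key j := fun h => hij (key_inj h)
    rcases lt_or_gt_of_ne this with h | h
    · simp [h, h.not_gt]; ring
    · simp [h, h.not_gt]; ring

def LV (m : ℕ) : (Idx m → ℚ) →ₗ[ℚ] Module.End ℚ (M m) :=
  ∑ j, (LinearMap.proj j).smulRight (L j)

def DV (m : ℕ) : (Idx m → ℚ) →ₗ[ℚ] Module.End ℚ (M m) :=
  ∑ j, (LinearMap.proj j).smulRight (D j)

lemma LV_apply {m : ℕ} (w : Idx m → ℚ) : LV m w = ∑ j, w j • L j := by
  simp [LV]

lemma DV_apply {m : ℕ} (w : Idx m → ℚ) : DV m w = ∑ j, w j • D j := by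
  simp [DV]

lemma LVLV {m : ℕ} (v w : Idx m → ℚ) : LV m v * LV m w + LV m w * LV m v = 0 := by
  simp only [LV_apply, Finset.sum_mul_sum]
  rw [Finset.sum_comm (γ := Idx m) (f := fun i j => w i • L i * v j • L j),
    ← Finset.sum_add_distrib]
  refine Finset.sum_eq_zero fun i _ => ?_
  rw [← Finset.sum_add_distrib]
  refine Finset.sum_eq_zero fun j _ => ?_
  rw [smul_mul_smul_comm, smul_mul_smul_comm, mul_comm (w j), ← smul_add, LL, smul_zero]

lemma LVsq {m : ℕ} (v : Idx m → ℚ) : LV m v * LV m v = 0 := by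
  have := LVLV v v
  rw [← two_smul ℚ] at this
  simpa using this

lemma DVLV {m : ℕ} (v w : Idx m → ℚ) :
    DV m v * LV m w + LV m w * DV m v = (∑ j, v j * w j) • 1 := by
  simp only [LV_apply, DV_apply, Finset.sum_mul_sum]
  rw [Finset.sum_comm (γ := Idx m) (f := fun i j => w i • L i * v j • D j),
    ← Finset.sum_add_distrib, Finset.sum_smul]
  refine Finset.sum_congr rfl fun i _ => ?_
  rw [← Finset.sum_add_distrib, Finset.sum_eq_single i]
  · rw [smul_mul_smul_comm, smul_mul_smul_comm, mul_comm (w i), ← smul_add, DL, if_pos rfl]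
  · intro j _ hj
    rw [smul_mul_smul_comm, smul_mul_smul_comm, mul_comm (w j), ← smul_add, DL, if_neg hj.symm,
      smul_zero]
  · simp

/-- vacuum -/
def vac (m : ℕ) : M m := Pi.single ∅ 1

section Phi
variable {m : ℕ} (a : (Fin (2 * m) → ℚ) →ₗ[ℚ] (Idx m → ℚ))

def PhiAlg : ExteriorAlgebra ℚ (Fin (2 * m) → ℚ) →ₐ[ℚ] Module.End ℚ (M m) :=
  ExteriorAlgebra.lift ℚ ⟨(LV m).comp a, fun v => LVsq (a v)⟩

def Phi : ExteriorAlgebra ℚ (Fin (2 * m) → ℚ) →ₗ[ℚ] M m :=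
  (LinearMap.applyₗ (vac m)).comp (PhiAlg a).toLinearMap

lemma Phi_ι_mul (v : Fin (2 * m) → ℚ) (x : ExteriorAlgebra ℚ (Fin (2 * m) → ℚ)) :
    Phi a (ExteriorAlgebra.ι ℚ v * x) = LV m (a v) (Phi a x) := by
  simp [Phi, PhiAlg]

lemma Phi_algebraMap (r : ℚ) :
    Phi a (algebraMap ℚ _ r) = r • vac m := by
  simp [Phi, Module.algebraMap_end_apply]

lemma Phi_extT (i : ℕ) (φ : Idx m → ℚ)
    (hφ : ∀ v, ∑ j, φ j * a v j = entry (2 * m) v (i - 1) - entry (2 * m) v (i + 1))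
    (x : ExteriorAlgebra ℚ (Fin (2 * m) → ℚ)) :
    Phi a (extT (2 * m) i x) =
      Phi a x + LV m (a (bas (2 * m) i)) (DV m φ (Phi a x)) := by
  set c := a (bas (2 * m) i) with hcdef
  induction x using CliffordAlgebra.left_induction with
  | algebraMap r =>
    have h0 : DV m φ (vac m) = 0 := by
      rw [DV_apply]
      ext S
      simp only [LinearMap.sum_apply, Finset.sum_apply, LinearMap.smul_apply, Pi.smul_apply,
        D_apply, vac]
      apply Finset.sum_eq_zero
      intro j _
      simp [Pi.single_apply]
    have h1 := Phi_algebraMap a r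
    have h2 : extT (2 * m) i (algebraMap ℚ _ r) = algebraMap ℚ _ r := AlgHom.commutes _ _
    erw [h2, h1]
    simp [h0]
  | add x y hx hy =>
    simp only [map_add, hx, hy]
    abel
  | ι_mul x v hx =>
    have e1 : extT (2 * m) i (ExteriorAlgebra.ι ℚ v * x) =
        ExteriorAlgebra.ι ℚ (T (2 * m) i v) * extT (2 * m) i x := by
      simp [extT]
    change Phi a (extT (2 * m) i (ExteriorAlgebra.ι ℚ v * x)) =
      Phi a (ExteriorAlgebra.ι ℚ v * x) + LV m c (DV m φ (Phi a (ExteriorAlgebra.ι ℚ v * x)))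
    rw [e1, Phi_ι_mul, Phi_ι_mul, hx]
    set y := Phi a x
    have e2 : a (T (2 * m) i v) = a v + (∑ j, φ j * a v j) • c := by
      rw [hφ, hcdef, ← map_smul, ← map_add]; rfl
    rw [e2]
    set s := ∑ j, φ j * a v j with hs
    have k1 := LinearMap.congr_fun (DVLV φ (a v)) y
    have k2 := LinearMap.congr_fun (LVLV c (a v)) (DV m φ y)
    have k3 := LinearMap.congr_fun (LVsq c) (DV m φ y)
    simp only [LinearMap.add_apply, Module.End.mul_apply, LinearMap.smul_apply,
      Module.End.one_apply, LinearMap.zero_apply, ← hs] at k1 k2 k3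
    rw [eq_sub_of_add_eq k1]
    simp only [map_add, map_sub, map_smul, LinearMap.add_apply, LinearMap.smul_apply, k3,
      eq_neg_of_add_eq_zero_left k2]
    simp
    abel

lemma Phi_surj (ha : Function.Surjective a) : Function.Surjective (Phi a) := by
  rw [← LinearMap.range_eq_top, eq_top_iff]
  have hL : ∀ (j : Idx m) (f : M m), f ∈ LinearMap.range (Phi a) →
      L j f ∈ LinearMap.range (Phi a) := by
    rintro j _ ⟨x, rfl⟩
    obtain ⟨v, hv⟩ := ha (Pi.single j 1)
    refine ⟨ExteriorAlgebra.ι ℚ v * x, ?_⟩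
    rw [Phi_ι_mul, hv, LV_apply]
    simp [Pi.single_apply]
  have key1 : ∀ S : Finset (Idx m), (Pi.single S 1 : M m) ∈ LinearMap.range (Phi a) := by
    intro S
    induction S using Finset.induction_on with
    | empty =>
      refine ⟨1, ?_⟩
      have := Phi_algebraMap a 1
      simpa [vac] using this
    | insert i S hi ih =>
      have h := hL i _ ih
      have : L i (Pi.single S 1 : M m) = sg i S • (Pi.single (insert i S) 1 : M m) := by
        ext R
        simp only [L_apply, Pi.smul_apply, smul_eq_mul, Pi.single_apply]
        by_cases hR : R = insert i S
        · subst hR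
          simp [hi, sg_insert]
        · rw [if_neg hR]
          split_ifs with h1 h2
          · exact absurd (by rw [← h2, Finset.insert_erase h1]) hR
          · simp
          · simp
      rw [this] at h
      exact (Submodule.smul_mem_iff _ (sg_ne i S)).1 h
  intro f _
  have : f = ∑ S, f S • (Pi.single S 1 : M m) := by
    ext R
    simp [Finset.sum_apply, Pi.single_apply]
  rw [this]
  exact Submodule.sum_mem _ fun S _ => Submodule.smul_mem _ _ (key1 S)

lemma Phi_bij (ha : Function.Surjective a) : Function.Bijective (Phi a) := by
  have b := (Pi.basisFun ℚ (Fin (2 * m))).ExteriorAlgebra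
  have : FiniteDimensional ℚ (ExteriorAlgebra ℚ (Fin (2 * m) → ℚ)) :=
    Module.Basis.finiteDimensional_of_finite b
  have hd : Module.finrank ℚ (ExteriorAlgebra ℚ (Fin (2 * m) → ℚ)) = Module.finrank ℚ (M m) := by
    rw [Module.finrank_eq_card_basis b]
    simp [mul_comm]
  have hs := Phi_surj a ha
  exact ⟨(LinearMap.injective_iff_surjective_of_finrank_eq_finrank hd).2 hs, hs⟩

end Phi

lemma LD_apply {m : ℕ} {i j : Idx m} (hij : i ≠ j) (f : M m) (S : Finset (Idx m)) :
    L i (D j f) S = if i ∈ S ∧ j ∉ S then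
      sg i S * sg j (S.erase i) * f (insert j (S.erase i)) else 0 := by
  rw [L_apply, D_apply]
  by_cases hi : i ∈ S <;> by_cases hj : j ∈ S <;> simp [hi, hj, hij.symm, mul_assoc]

lemma LD_zero_iff {m : ℕ} {i j : Idx m} (hij : i ≠ j) (f : M m) :
    L i (D j f) = 0 ↔ ∀ S, j ∈ S → i ∉ S → f S = 0 := by
  constructor
  · intro h S hj hi
    have h1 := congrFun h (insert i (S.erase j))
    rw [LD_apply hij, if_pos (by simp [hij.symm])] at h1
    have e : insert j ((insert i (S.erase j)).erase i) = S := by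
      rw [Finset.erase_insert (by simp [hi]), Finset.insert_erase hj]
    rw [e] at h1
    simpa [sg_ne] using h1
  · intro h
    ext S
    rw [LD_apply hij]
    split_ifs with h1
    · rw [h _ (by simp) (by simp [hij])]; simp
    · rfl

def Bal {m : ℕ} (k : Fin m) (f : M m) : Prop :=
  ∀ S, ¬ ((k, false) ∈ S ↔ (k, true) ∈ S) → f S = 0

lemma bal_iff {m : ℕ} (k : Fin m) (f : M m) :
    Bal k f ↔ L (k, true) (D (k, false) f) = 0 ∧ L (k, false) (D (k, true) f) = 0 := by
  rw [LD_zero_iff (by simp), LD_zero_iff (by simp)]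
  constructor
  · intro h
    exact ⟨fun S h1 h2 => h S (by tauto), fun S h1 h2 => h S (by tauto)⟩
  · rintro ⟨h1, h2⟩ S hS
    by_cases h : (k, false) ∈ S
    · exact h1 S h (by tauto)
    · exact h2 S (by tauto) h

/-- the mixed operator -/
def Mix {m : ℕ} (k l : Fin m) (f : M m) : M m :=
  L (l, false) (D (k, true) f) - L (l, false) (D (l, true) f)
    - L (k, false) (D (k, true) f) + L (k, false) (D (l, true) f)

lemma bal_step {m : ℕ} {k l : Fin m} (hkl : k ≠ l) (f : M m) (hk : Bal k f)
    (h1 : L (l, true) (D (l, false) f) = 0) (hc : Mix k l f = 0) : Bal l f := by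
  rw [bal_iff]
  refine ⟨h1, ?_⟩
  rw [LD_zero_iff (by simp)]
  intro S hq hp
  by_cases hb : ((k, false) ∈ S ↔ (k, true) ∈ S)
  swap
  · exact hk S hb
  have h2 := congrFun hc (insert (l, false) (S.erase (l, true)))
  simp only [Mix, Pi.add_apply, Pi.sub_apply, Pi.zero_apply] at h2
  have hlk := hkl.symm
  rw [LD_apply (by simp), LD_apply (by simp), LD_apply (by simp), LD_apply (by simp)] at h2
  have t1 : (insert (l, true) ((insert (l, false) (S.erase (l, true))).erase (l, false))) = S := by
    rw [Finset.erase_insert (by simp [hp]), Finset.insert_erase hq]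
  rw [t1] at h2
  have t3 : ¬ ((k, false) ∈ (insert (l, false) (S.erase (l, true))) ∧
      (k, true) ∉ (insert (l, false) (S.erase (l, true)))) := by
    simp [hkl, hb]
  rw [if_neg t3] at h2
  have t2 : ((l, false) ∈ (insert (l, false) (S.erase (l, true))) ∧
      (l, true) ∉ (insert (l, false) (S.erase (l, true)))) := by simp
  rw [if_pos t2] at h2
  have t4 : (if (l, false) ∈ insert (l, false) (S.erase (l, true)) ∧
      (k, true) ∉ insert (l, false) (S.erase (l, true)) then
      sg (l, false) (insert (l, false) (S.erase (l, true))) *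
          sg (k, true) ((insert (l, false) (S.erase (l, true))).erase (l, false)) *
        f (insert (k, true) ((insert (l, false) (S.erase (l, true))).erase (l, false)))
    else 0) = 0 := by
    split_ifs with h
    · rw [hk, mul_zero]
      simp [hkl] at h ⊢
      tauto
    · rfl
  have t5 : (if (k, false) ∈ insert (l, false) (S.erase (l, true)) ∧
      (l, true) ∉ insert (l, false) (S.erase (l, true)) then
      sg (k, false) (insert (l, false) (S.erase (l, true))) *
          sg (l, true) ((insert (l, false) (S.erase (l, true))).erase (k, false)) *
        f (insert (l, true) ((insert (l, false) (S.erase (l, true))).erase (k, false)))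
    else 0) = 0 := by
    split_ifs with h
    · rw [hk, mul_zero]
      simp [hkl] at h ⊢
      tauto
    · rfl
  rw [t4, t5] at h2
  simpa [sg_ne] using h2

def theta {m : ℕ} (k : Fin m) (R : Finset (Idx m)) : Finset (Idx m) :=
  insert (k, true) (insert (k, false) R)

def Clean {m : ℕ} (k : Fin m) (R : Finset (Idx m)) : Prop := ∀ b, (k, b) ∉ R

lemma sg_congr {m : ℕ} {i i' : Idx m} {R : Finset (Idx m)}
    (h : ∀ j ∈ R, (key j < key i ↔ key j < key i')) : sg i R = sg i' R := by
  unfold sg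
  exact Finset.prod_congr rfl fun j hj => by simp only [h j hj]

lemma cross {m : ℕ} {k l : Fin m} (hkl : k.val + 1 = l.val) (f : M m) (R : Finset (Idx m))
    (hk : Clean k R) (hl : Clean l R) :
    (L (l, false) (D (k, true) f) + L (k, false) (D (l, true) f))
      (insert (k, false) (insert (l, false) R)) = f (theta k R) - f (theta l R) := by
  have hne : k ≠ l := by rintro rfl; omega
  have hne' := hne.symm
  have hkf := hk false
  have hkt := hk true
  have hlf := hl false
  have hlt := hl true
  have kj : ∀ j ∈ R, key j ≠ 2 * k.val ∧ key j ≠ 2 * k.val + 1 ∧ key j ≠ 2 * l.val ∧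
      key j ≠ 2 * l.val + 1 := by
    intro j hj
    have a1 : key (k, false) = 2 * k.val := by simp [key]
    have a2 : key (k, true) = 2 * k.val + 1 := by simp [key]
    have a3 : key (l, false) = 2 * l.val := by simp [key]
    have a4 : key (l, true) = 2 * l.val + 1 := by simp [key]
    rw [← a2, ← a1, ← a4, ← a3]
    refine ⟨fun h => ?_, fun h => ?_, fun h => ?_, fun h => ?_⟩ <;>
      (rw [key_inj h] at hj; contradiction)
  have s1 : sg (k, true) R = sg (k, false) R := sg_congr fun j hj => by
    have := kj j hj; simp only [key] at *; simp; omega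
  have s2 : sg (l, false) R = sg (k, false) R := sg_congr fun j hj => by
    have := kj j hj; simp only [key] at *; simp; omega
  have s3 : sg (l, true) R = sg (k, false) R := sg_congr fun j hj => by
    have := kj j hj; simp only [key] at *; simp; omega
  rw [Pi.add_apply, LD_apply (by simp), LD_apply (by simp), if_pos (by simp [hne, hkt]),
    if_pos (by simp [hne', hlt])]
  rw [Finset.erase_insert (a := (k, false)) (by simp [hne, hkf]),
    Finset.insert_comm (k, false) (l, false),
    Finset.erase_insert (a := (l, false)) (by simp [hne', hlf])]
  rw [sg_insert _ _ _ (by simp [hne', hlf]), sg_insert _ _ _ hkf, sg_insert _ _ _ hkf,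
    sg_insert _ _ _ (by simp [hne', hlf]), sg_insert _ _ _ hkf, sg_insert _ _ _ hlf,
    s1, s2, s3]
  have := sg_sq (k, false) R
  have c1 : key (k, false) < key (l, false) := by simp [key]; omega
  have c2 : ¬ key (l, false) < key (k, false) := by simp [key]; omega
  have c3 : key (k, false) < key (k, true) := by simp [key]
  have c4 : key (l, false) < key (l, true) := by simp [key]
  simp only [c1, c2, c3, c4, if_true, if_false, lt_irrefl, theta]
  linear_combination (f (insert (k, true) (insert (k, false) R)) -
    f (insert (l, true) (insert (l, false) R))) * this

def Swap {m : ℕ} (k l : Fin m) (f : M m) : Prop :=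
  ∀ R, Clean k R → Clean l R → f (theta k R) = f (theta l R)

lemma mix_iff {m : ℕ} {k l : Fin m} (hkl : k.val + 1 = l.val) (f : M m)
    (hk : Bal k f) (hl : Bal l f) : Mix k l f = 0 ↔ Swap k l f := by
  have hne : k ≠ l := by rintro rfl; omega
  have hne' := hne.symm
  have e : Mix k l f = L (l, false) (D (k, true) f) + L (k, false) (D (l, true) f) := by
    rw [Mix, ((bal_iff k f).1 hk).2, ((bal_iff l f).1 hl).2]; simp
  rw [e]
  constructor
  · intro h R h1 h2
    have := cross hkl f R h1 h2
    rw [h] at this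
    simp at this
    linarith
  · intro h
    ext S
    by_cases hS : (k, false) ∈ S ∧ (l, false) ∈ S ∧ (k, true) ∉ S ∧ (l, true) ∉ S
    · obtain ⟨h1, h2, h3, h4⟩ := hS
      set R := (S.erase (k, false)).erase (l, false) with hR
      have hSR : S = insert (k, false) (insert (l, false) R) := by
        rw [hR, Finset.insert_erase (by simp [h2, hne']), Finset.insert_erase h1]
      have ck : Clean k R := by rintro (_ | _) <;> simp [hR, h3]
      have cl : Clean l R := by rintro (_ | _) <;> simp [hR, h4]
      rw [hSR, cross hkl f R ck cl, h R ck cl]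
      simp
    · rw [Pi.add_apply, LD_apply (by simp), LD_apply (by simp)]
      have t1 : ∀ c : ℚ, (l, false) ∈ S ∧ (k, true) ∉ S →
          f (insert (k, true) (S.erase (l, false))) = 0 := by
        intro _ hh
        by_cases h1 : (k, false) ∈ S
        · apply hl
          simp [hne']
          tauto
        · apply hk
          simp [hne, h1]
      have t2 : ∀ c : ℚ, (k, false) ∈ S ∧ (l, true) ∉ S →
          f (insert (l, true) (S.erase (k, false))) = 0 := by
        intro _ hh
        by_cases h1 : (l, false) ∈ S
        · apply hk
          simp [hne]
          tauto
        · apply hl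
          simp [hne', h1]
      split_ifs with a1 a2 a2
      · rw [t1 0 a1, t2 0 a2]; simp
      · rw [t1 0 a1]; simp
      · rw [t2 0 a2]; simp
      · simp

def ee {m : ℕ} (u k : Fin m) : ℚ := if k = u then 0 else 1

def Good {m : ℕ} (u : Fin m) (f : M m) : Prop :=
  (∀ k, k ≠ u → Bal k f) ∧
    ∀ k l : Fin m, k.val + 1 = l.val → k ≠ u → l ≠ u → Swap k l f

def Cond {m : ℕ} (u : Fin m) (f : M m) : Prop :=
  (∀ k, k ≠ u → L (k, true) (D (k, false) f) = 0) ∧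
    ∀ k l : Fin m, k.val + 1 = l.val →
      (ee u l • L (l, false) - ee u k • L (k, false))
        ((ee u k • D (k, true) - ee u l • D (l, true)) f) = 0

lemma mix_symm {m : ℕ} (k l : Fin m) (f : M m) : Mix k l f = Mix l k f := by
  unfold Mix; abel

lemma cond_iff_good {m : ℕ} (u : Fin m) (f : M m) : Cond u f ↔ Good u f := by
  have hmix : ∀ k l : Fin m, k ≠ u → l ≠ u →
      (ee u l • L (l, false) - ee u k • L (k, false))
        ((ee u k • D (k, true) - ee u l • D (l, true)) f) = Mix k l f := by
    intro k l hk hl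
    simp [ee, hk, hl, Mix]
    abel
  have hu1 : ∀ k l : Fin m, k = u → l ≠ u →
      (ee u l • L (l, false) - ee u k • L (k, false))
        ((ee u k • D (k, true) - ee u l • D (l, true)) f) = - L (l, false) (D (l, true) f) := by
    intro k l hk hl
    simp [ee, hk, hl]
  have hu2 : ∀ k l : Fin m, k ≠ u → l = u →
      (ee u l • L (l, false) - ee u k • L (k, false))
        ((ee u k • D (k, true) - ee u l • D (l, true)) f) = - L (k, false) (D (k, true) f) := by
    intro k l hk hl
    simp [ee, hk, hl]
  constructor
  · rintro ⟨h1, h2⟩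
    have right : ∀ d : ℕ, ∀ k : Fin m, k.val = u.val + 1 + d → Bal k f := by
      intro d
      induction d with
      | zero =>
        intro k hk
        have hne : k ≠ u := by rintro rfl; omega
        have := h2 u k (by omega)
        rw [hu1 u k rfl hne] at this
        exact (bal_iff k f).2 ⟨h1 k hne, neg_eq_zero.1 this⟩
      | succ d ih =>
        intro k hk
        have hne : k ≠ u := by rintro rfl; omega
        let j : Fin m := ⟨u.val + 1 + d, by omega⟩
        have hj : j.val = u.val + 1 + d := rfl
        have hju : j ≠ u := by intro h; have := congrArg Fin.val h; omega
        have hjk : j ≠ k := by intro h; have := congrArg Fin.val h; omega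
        have := h2 j k (by omega)
        rw [hmix j k hju hne] at this
        exact bal_step hjk f (ih j hj) (h1 k hne) this
    have left : ∀ d : ℕ, ∀ k : Fin m, k.val + 1 + d = u.val → Bal k f := by
      intro d
      induction d with
      | zero =>
        intro k hk
        have hne : k ≠ u := by rintro rfl; omega
        have := h2 k u (by omega)
        rw [hu2 k u hne rfl] at this
        exact (bal_iff k f).2 ⟨h1 k hne, neg_eq_zero.1 this⟩
      | succ d ih =>
        intro k hk
        have hne : k ≠ u := by rintro rfl; omega
        let j : Fin m := ⟨k.val + 1, by omega⟩
        have hj : j.val = k.val + 1 := rfl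
        have hju : j ≠ u := by intro h; have := congrArg Fin.val h; omega
        have hjk : j ≠ k := by intro h; have := congrArg Fin.val h; omega
        have := h2 k j (by omega)
        rw [hmix k j hne hju, mix_symm] at this
        exact bal_step hjk f (ih j (by omega)) (h1 k hne) this
    have hb : ∀ k, k ≠ u → Bal k f := by
      intro k hk
      have : k.val ≠ u.val := fun h => hk (Fin.ext h)
      rcases lt_or_gt_of_ne this with h | h
      · exact left (u.val - k.val - 1) k (by omega)
      · exact right (k.val - u.val - 1) k (by omega)
    refine ⟨hb, fun k l hkl hk hl => ?_⟩
    have := h2 k l hkl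
    rw [hmix k l hk hl] at this
    exact (mix_iff hkl f (hb k hk) (hb l hl)).1 this
  · rintro ⟨hb, hw⟩
    refine ⟨fun k hk => ((bal_iff k f).1 (hb k hk)).1, fun k l hkl => ?_⟩
    by_cases hk : k = u
    · have hl : l ≠ u := by rintro rfl; subst hk; omega
      rw [hu1 k l hk hl, ((bal_iff l f).1 (hb l hl)).2, neg_zero]
    · by_cases hl : l = u
      · rw [hu2 k l hk hl, ((bal_iff k f).1 (hb k hk)).2, neg_zero]
      · rw [hmix k l hk hl]
        exact (mix_iff hkl f (hb k hk) (hb l hl)).2 (hw k l hkl hk hl)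

lemma entry_bas (n i j : ℕ) :
    entry n (bas n i) j = if i = j ∧ 1 ≤ j ∧ j ≤ n then 1 else 0 := by
  unfold entry bas
  by_cases h : 1 ≤ j ∧ j ≤ n
  · rw [dif_pos h]
    by_cases hij : i = j
    · rw [if_pos (by simp; omega), if_pos ⟨hij, h⟩]
    · rw [if_neg (by simp; omega), if_neg (by tauto)]
  · rw [dif_neg h, if_neg (by tauto)]

lemma entry_out (n : ℕ) (v : Fin n → ℚ) (j : ℕ) (h : n < j) : entry n v j = 0 := by
  unfold entry
  rw [dif_neg (by omega)]

def aMap (m : ℕ) (u : Fin m) : (Fin (2 * m) → ℚ) →ₗ[ℚ] (Idx m → ℚ) where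
  toFun v i :=
    if i.2 then
      (if i.1 = u then entry (2 * m) v (2 * u.val + 2)
        else entry (2 * m) v (2 * i.1.val + 2) - entry (2 * m) v (2 * u.val + 2))
    else
      (if i.1 = u then entry (2 * m) v 1
        else entry (2 * m) v (2 * i.1.val + 1) - entry (2 * m) v (2 * i.1.val + 3))
  map_add' v w := by
    ext i; simp only [entry_add, Pi.add_apply]; split_ifs <;> ring
  map_smul' c v := by
    ext i; simp only [entry_smul, Pi.smul_apply, smul_eq_mul, RingHom.id_apply]
    split_ifs <;> ring

lemma aMap_true {m : ℕ} (u k : Fin m) (v) : aMap m u v (k, true) =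
    if k = u then entry (2 * m) v (2 * u.val + 2)
        else entry (2 * m) v (2 * k.val + 2) - entry (2 * m) v (2 * u.val + 2) := by
  simp [aMap]

lemma aMap_false {m : ℕ} (u k : Fin m) (v) : aMap m u v (k, false) =
    if k = u then entry (2 * m) v 1
        else entry (2 * m) v (2 * k.val + 1) - entry (2 * m) v (2 * k.val + 3) := by
  simp [aMap]

lemma aMap_surj {m : ℕ} (u : Fin m) : Function.Surjective (aMap m u) := by
  have hd : Module.finrank ℚ (Fin (2 * m) → ℚ) = Module.finrank ℚ (Idx m → ℚ) := by
    simp [mul_comm]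
  rw [← LinearMap.injective_iff_surjective_of_finrank_eq_finrank hd, injective_iff_map_eq_zero]
  intro v hv
  have he : ∀ k : Fin m, entry (2 * m) v (2 * k.val + 2) = 0 := by
    have h0 : entry (2 * m) v (2 * u.val + 2) = 0 := by
      have := congrFun hv (u, true)
      simpa [aMap_true] using this
    intro k
    by_cases hk : k = u
    · rw [hk, h0]
    · have := congrFun hv (k, true)
      simpa [aMap_true, hk, h0] using this
  have hs : ∀ k : Fin m, k ≠ u →
      entry (2 * m) v (2 * k.val + 1) = entry (2 * m) v (2 * k.val + 3) := by
    intro k hk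
    have := congrFun hv (k, false)
    simpa [aMap_false, hk, sub_eq_zero] using this
  have hl : ∀ d : ℕ, d ≤ u.val → entry (2 * m) v (2 * d + 1) = 0 := by
    intro d
    induction d with
    | zero =>
      intro _
      have := congrFun hv (u, false)
      simpa [aMap_false] using this
    | succ d ih =>
      intro h
      have := hs ⟨d, by omega⟩ (by intro h'; have := congrArg Fin.val h'; simp at this; omega)
      simp only [ih (by omega)] at this
      exact this.symm
  have hr : ∀ d : ℕ, d + u.val < m → entry (2 * m) v (2 * (m - d) + 1) = 0 := by
    intro d
    induction d with
    | zero => intro _; exact entry_out _ _ _ (by omega)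
    | succ d ih =>
      intro h
      have := hs ⟨m - (d + 1), by omega⟩
        (by intro h'; have := congrArg Fin.val h'; simp at this; omega)
      simp only at this
      rw [this, ← ih (by omega)]
      congr 1
      omega
  ext j
  have hj : v j = entry (2 * m) v (j.val + 1) := by
    unfold entry
    rw [dif_pos (by omega)]
    rfl
  rw [hj, Pi.zero_apply]
  rcases Nat.even_or_odd' j.val with ⟨k, hk | hk⟩
  · rw [hk]
    by_cases hku : k ≤ u.val
    · exact hl k hku
    · have := hr (m - k) (by omega)
      rwa [show m - (m - k) = k by omega] at this
  · rw [hk]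
    exact he ⟨k, by omega⟩

lemma aMap_bas_even {m : ℕ} (u k : Fin m) (hk : k ≠ u) :
    aMap m u (bas (2 * m) (2 * k.val + 2)) = Pi.single (k, true) 1 := by
  have hk' : k.val ≠ u.val := fun h => hk (Fin.ext h)
  ext ⟨k', b⟩
  have := k.2
  have := u.2
  have := k'.2
  cases b
  · rw [aMap_false]
    simp only [entry_bas, Pi.single_apply, Prod.mk.injEq, Fin.ext_iff]
    split_ifs <;> simp_all <;> omega
  · rw [aMap_true]
    simp only [entry_bas, Pi.single_apply, Prod.mk.injEq, Fin.ext_iff]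
    split_ifs <;> simp_all <;> omega

lemma aMap_bas_odd {m : ℕ} (u k l : Fin m) (hkl : k.val + 1 = l.val) :
    aMap m u (bas (2 * m) (2 * l.val + 1)) =
      ee u l • Pi.single (l, false) 1 - ee u k • Pi.single (k, false) 1 := by
  ext ⟨k', b⟩
  have := k.2
  have := l.2
  have := u.2
  have := k'.2
  cases b
  · rw [aMap_false]
    simp only [entry_bas, Pi.single_apply, Prod.mk.injEq, Fin.ext_iff, ee, Pi.sub_apply,
      Pi.smul_apply, smul_eq_mul, and_true]
    split_ifs <;> first | omega | norm_num
  · rw [aMap_true]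
    simp only [entry_bas, Pi.single_apply, Prod.mk.injEq, ee, Pi.sub_apply,
      Pi.smul_apply, smul_eq_mul, Fin.ext_iff]
    split_ifs <;> first | omega | simp_all

lemma LV_single {m : ℕ} (i : Idx m) : LV m (Pi.single i 1) = L i := by
  rw [LV_apply]; simp [Pi.single_apply]

lemma DV_single {m : ℕ} (i : Idx m) : DV m (Pi.single i 1) = D i := by
  rw [DV_apply]; simp [Pi.single_apply]

lemma inv_even {m : ℕ} (u k : Fin m) (hk : k ≠ u) (x) :
    extT (2 * m) (2 * k.val + 2) x = x ↔
      L (k, true) (D (k, false) (Phi (aMap m u) x)) = 0 := by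
  rw [← (Phi_bij (aMap m u) (aMap_surj u)).1.eq_iff,
    Phi_extT (aMap m u) (2 * k.val + 2) (Pi.single (k, false) 1), aMap_bas_even u k hk,
    LV_single, DV_single]
  · simp
  · intro v
    simp [Pi.single_apply, aMap_false, hk]

lemma inv_odd {m : ℕ} (u k l : Fin m) (hkl : k.val + 1 = l.val) (x) :
    extT (2 * m) (2 * l.val + 1) x = x ↔
      (ee u l • L (l, false) - ee u k • L (k, false))
        ((ee u k • D (k, true) - ee u l • D (l, true)) (Phi (aMap m u) x)) = 0 := by
  rw [← (Phi_bij (aMap m u) (aMap_surj u)).1.eq_iff,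
    Phi_extT (aMap m u) (2 * l.val + 1)
      (ee u k • Pi.single (k, true) 1 - ee u l • Pi.single (l, true) 1), aMap_bas_odd u k l hkl,
    map_sub, map_sub, map_smul, map_smul, map_smul, map_smul, LV_single, LV_single, DV_single,
    DV_single, add_eq_left]
  intro v
  have e1 : ∀ i : Idx m, ∑ j, (Pi.single i 1 : Idx m → ℚ) j * aMap m u v j = aMap m u v i := by
    intro i; simp [Pi.single_apply]
  simp only [Pi.sub_apply, Pi.smul_apply, smul_eq_mul, sub_mul, mul_assoc,
    Finset.sum_sub_distrib, ← Finset.mul_sum, e1]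
  have hne : k ≠ l := by rintro rfl; omega
  simp only [aMap_true, ee]
  rw [show 2 * l.val + 1 - 1 = 2 * k.val + 2 by omega]
  by_cases hk : k = u
  · have hl : l ≠ u := by rintro rfl; exact hne hk
    simp [hk, hl]
  · by_cases hl : l = u
    · simp [hk, hl]
    · simp [hk, hl]

lemma mem_inv {m : ℕ} (u : Fin m) (x) :
    x ∈ invSub (2 * m) {i | (2 ≤ i ∧ i ≤ 2 * u.val + 1) ∨ (2 * u.val + 1 + 2 ≤ i ∧ i ≤ 2 * m)}
      ↔ Cond u (Phi (aMap m u) x) := by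
  simp only [invSub, Submodule.mem_iInf, LinearMap.mem_eqLocus, Set.mem_setOf_eq,
    AlgHom.toLinearMap_apply, LinearMap.id_apply, Cond]
  constructor
  · intro h
    refine ⟨fun k hk => ?_, fun k l hkl => ?_⟩
    · rw [← inv_even u k hk]
      apply h
      have hk' : k.val ≠ u.val := fun h => hk (Fin.ext h)
      omega
    · rw [← inv_odd u k l hkl]
      apply h
      omega
  · rintro ⟨h1, h2⟩ i hi
    rcases Nat.even_or_odd' i with ⟨k, rfl | rfl⟩
    · have := (inv_even u ⟨k - 1, by omega⟩ (by simp [Fin.ext_iff]; omega) x).2 (h1 _ (by simp [Fin.ext_iff]; omega))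
      simp only at this
      rwa [show 2 * (k - 1) + 2 = 2 * k by omega] at this
    · exact (inv_odd u ⟨k - 1, by omega⟩ ⟨k, by omega⟩ (by simp; omega) x).2
        (h2 _ _ (by simp; omega))

def side {m : ℕ} (u k : Fin m) : ℕ := if k.val < u.val then 0 else if k.val = u.val then 1 else 2

lemma far_swap {m : ℕ} (u : Fin m) (F : Finset (Fin m) → ℚ)
    (hadj : ∀ (k l : Fin m) A, k.val + 1 = l.val → side u k = side u l → k ∉ A → l ∉ A →
      F (insert k A) = F (insert l A)) :
    ∀ (d : ℕ) (k l : Fin m) A, k.val + d = l.val → side u k = side u l → k ∉ A → l ∉ A →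
      F (insert k A) = F (insert l A) := by
  intro d
  induction d with
  | zero =>
    intro k l A h _ _ _
    have : k = l := Fin.ext (by omega)
    rw [this]
  | succ d ih =>
    intro k l A h hs hk hl
    obtain ⟨j, hj⟩ : ∃ j : Fin m, j.val = k.val + d := ⟨⟨k.val + d, by omega⟩, rfl⟩
    have hjl : side u j = side u l := by
      unfold side at hs ⊢; split_ifs at hs ⊢ <;> omega
    have hne1 : j ≠ l := by rintro rfl; omega
    have hne2 : k ≠ l := by rintro rfl; omega
    by_cases hjA : j ∈ A
    · have hjk : j ≠ k := by rintro rfl; exact hk hjA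
      obtain ⟨B, hjB, rfl⟩ : ∃ B, j ∉ B ∧ A = insert j B :=
        ⟨A.erase j, by simp, (Finset.insert_erase hjA).symm⟩
      simp only [Finset.mem_insert, not_or] at hk hl
      rw [Finset.insert_comm k j, hadj j l _ (by omega) hjl (by simp [hjk, hjB])
        (by simp [hne2.symm, hl.2]), Finset.insert_comm l k,
        ih k j _ (by omega) (hs.trans hjl.symm) (by simp [hne2, hk.2]) (by simp [hne1, hjB]),
        Finset.insert_comm j l]
    · rw [← hadj j l A (by omega) hjl hjA hl]
      exact ih k j A (by omega) (hs.trans hjl.symm) hk hjA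

lemma same_count {m : ℕ} (sd : Fin m → ℕ) (F : Finset (Fin m) → ℚ)
    (hsw : ∀ (k l : Fin m) A, sd k = sd l → k ∉ A → l ∉ A → F (insert k A) = F (insert l A)) :
    ∀ (n : ℕ) (A B : Finset (Fin m)), (A \ B).card = n →
      (∀ s, (A.filter (fun k => sd k = s)).card = (B.filter (fun k => sd k = s)).card) →
      F A = F B := by
  intro n
  induction n with
  | zero =>
    intro A B h hc
    rw [Finset.card_eq_zero, Finset.sdiff_eq_empty_iff_subset] at h
    congr 1
    apply Finset.Subset.antisymm h
    intro k hk
    have := Finset.eq_of_subset_of_card_le (Finset.filter_subset_filter (fun j => sd j = sd k) h)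
      (hc (sd k)).ge
    have hk' : k ∈ B.filter (fun j => sd j = sd k) := by simp [hk]
    rw [← this] at hk'
    exact (Finset.mem_filter.1 hk').1
  | succ n ih =>
    intro A B h hc
    obtain ⟨k, hk⟩ : (A \ B).Nonempty := by rw [← Finset.card_pos]; omega
    have hkA := (Finset.mem_sdiff.1 hk).1
    have hkB := (Finset.mem_sdiff.1 hk).2
    obtain ⟨l, hlB, hlA, hl⟩ : ∃ l, l ∈ B ∧ l ∉ A ∧ sd l = sd k := by
      by_contra hcon
      push Not at hcon
      have hsub : B.filter (fun j => sd j = sd k) ⊆ A.filter (fun j => sd j = sd k) := by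
        intro l hl
        rw [Finset.mem_filter] at hl ⊢
        refine ⟨?_, hl.2⟩
        by_contra h'
        exact hcon l hl.1 h' hl.2
      have := Finset.eq_of_subset_of_card_le hsub (hc (sd k)).le
      have hk' : k ∈ A.filter (fun j => sd j = sd k) := by simp [hkA]
      rw [← this] at hk'
      exact hkB (Finset.mem_filter.1 hk').1
    have hkl : k ≠ l := by rintro rfl; exact hlA hkA
    have e1 : F A = F (insert l (A.erase k)) := by
      conv_lhs => rw [← Finset.insert_erase hkA]
      exact hsw k l _ hl.symm (by simp) (by simp [hlA])
    rw [e1]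
    apply ih
    · have : insert l (A.erase k) \ B = (A \ B).erase k := by
        ext j; simp only [Finset.mem_sdiff, Finset.mem_insert, Finset.mem_erase]
        constructor
        · rintro ⟨rfl | h, h2⟩
          · exact absurd hlB h2
          · tauto
        · tauto
      rw [this, Finset.card_erase_of_mem hk, h]; simp
    · intro s
      rw [← hc s]
      by_cases hs : sd k = s
      · rw [Finset.filter_insert, if_pos (by rw [hl, hs]), Finset.filter_erase,
          Finset.card_insert_of_notMem (by simp [hlA]),
          Finset.card_erase_of_mem (by simp [hkA, hs])]
        have : 0 < (A.filter (fun j => sd j = s)).card :=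
          Finset.card_pos.2 ⟨k, by simp [hkA, hs]⟩
        omega
      · rw [Finset.filter_insert, if_neg (by rw [hl]; exact hs), Finset.filter_erase,
          Finset.erase_eq_of_notMem (by simp [hs])]

def St {m : ℕ} (u : Fin m) (A : Finset (Fin m)) (x y : Bool) : Finset (Idx m) :=
  Finset.univ.filter fun i =>
    (i.1 ≠ u ∧ i.1 ∈ A) ∨ (i.1 = u ∧ i.2 = false ∧ x = true) ∨ (i.1 = u ∧ i.2 = true ∧ y = true)

lemma mem_St {m : ℕ} (u : Fin m) (A : Finset (Fin m)) (x y : Bool) (k : Fin m) (b : Bool) :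
    (k, b) ∈ St u A x y ↔
    (k ≠ u ∧ k ∈ A) ∨ (k = u ∧ b = false ∧ x = true) ∨ (k = u ∧ b = true ∧ y = true) := by
  simp [St]

def AllBal {m : ℕ} (u : Fin m) (S : Finset (Idx m)) : Prop :=
  ∀ k, k ≠ u → ((k, false) ∈ S ↔ (k, true) ∈ S)

def supp {m : ℕ} (S : Finset (Idx m)) : Finset (Fin m) :=
  Finset.univ.filter fun k => (k, false) ∈ S

def cnt {m : ℕ} (u : Fin m) (s : ℕ) (S : Finset (Idx m)) : ℕ :=
  ((supp S).filter fun k => side u k = s).card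

def canon {m : ℕ} (u : Fin m) (a b : ℕ) : Finset (Fin m) :=
  Finset.univ.filter fun k => (k.val < a ∧ k.val < u.val) ∨ (u.val < k.val ∧ k.val ≤ u.val + b)

lemma card_canon0 {m : ℕ} (u : Fin m) (a b : ℕ) (ha : a ≤ u.val) :
    ((canon u a b).filter fun k => side u k = 0).card = a := by
  have : ((canon u a b).filter fun k => side u k = 0) = Finset.Iio ⟨a, by omega⟩ := by
    ext k
    rw [Finset.mem_filter, canon, Finset.mem_filter]
    simp only [side, Finset.mem_univ, true_and, Finset.mem_Iio,
      Fin.lt_def]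
    split_ifs <;> first | omega | (simp; omega)
  rw [this, Fin.card_Iio]

lemma card_canon2 {m : ℕ} (u : Fin m) (a b : ℕ) (hb : u.val + b < m) :
    ((canon u a b).filter fun k => side u k = 2).card = b := by
  have : ((canon u a b).filter fun k => side u k = 2) = Finset.Ioc u ⟨u.val + b, hb⟩ := by
    ext k
    rw [Finset.mem_filter, canon, Finset.mem_filter]
    simp only [side, Finset.mem_univ, true_and, Finset.mem_Ioc,
      Fin.lt_def, Fin.le_def]
    split_ifs <;> first | omega | (simp; omega)
  rw [this, Fin.card_Ioc]
  simp

lemma cnt_le0 {m : ℕ} (u : Fin m) (S : Finset (Idx m)) : cnt u 0 S ≤ u.val := by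
  have h : ((supp S).filter fun k => side u k = 0) ⊆ Finset.Iio u := by
    intro k hk
    rw [Finset.mem_filter] at hk
    have := hk.2
    rw [Finset.mem_Iio, Fin.lt_def]
    unfold side at this
    split_ifs at this <;> omega
  exact (Finset.card_le_card h).trans (by simp)

lemma cnt_le2 {m : ℕ} (u : Fin m) (S : Finset (Idx m)) : u.val + cnt u 2 S < m := by
  have h : ((supp S).filter fun k => side u k = 2) ⊆ Finset.Ioi u := by
    intro k hk
    rw [Finset.mem_filter] at hk
    have := hk.2
    rw [Finset.mem_Ioi, Fin.lt_def]
    unfold side at this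
    split_ifs at this <;> omega
  have := Finset.card_le_card h
  rw [Fin.card_Ioi] at this
  unfold cnt
  omega

lemma theta_St {m : ℕ} (u k : Fin m) (hk : k ≠ u) (A : Finset (Fin m)) (x y : Bool) :
    theta k (St u A x y) = St u (insert k A) x y := by
  ext ⟨j, b⟩
  simp only [theta, Finset.mem_insert, mem_St, Prod.mk.injEq]
  by_cases hj : j = k
  · subst hj; cases b <;> simp [hk]
  · simp [hj]

lemma clean_St {m : ℕ} (u k : Fin m) (hk : k ≠ u) (A : Finset (Fin m)) (hA : k ∉ A) (x y : Bool) :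
    Clean k (St u A x y) := by
  intro b
  simp [mem_St, hk, hA]

lemma good_eval {m : ℕ} (u : Fin m) (f : M m) (hf : Good u f) (S : Finset (Idx m))
    (hS : AllBal u S) :
    f S = f (St u (canon u (cnt u 0 S) (cnt u 2 S)) (decide ((u, false) ∈ S))
      (decide ((u, true) ∈ S))) := by
  have e : S = St u ((supp S).erase u) (decide ((u, false) ∈ S)) (decide ((u, true) ∈ S)) := by
    ext ⟨k, b⟩
    rw [mem_St]
    by_cases hk : k = u
    · subst hk; cases b <;> simp
    · have := hS k hk
      cases b <;> simp [hk, supp, this]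
  conv_lhs => rw [e]
  refine same_count (side u) (fun A => f (St u A (decide ((u, false) ∈ S))
      (decide ((u, true) ∈ S)))) ?_ _ _ _ rfl ?_
  · have hadj : ∀ (k l : Fin m) (A : Finset (Fin m)), k.val + 1 = l.val → side u k = side u l →
      k ∉ A → l ∉ A →
      f (St u (insert k A) (decide ((u, false) ∈ S)) (decide ((u, true) ∈ S))) =
      f (St u (insert l A) (decide ((u, false) ∈ S)) (decide ((u, true) ∈ S))) := by
      intro k l A hkl hs hk hl
      have hku : k ≠ u := by
        rintro rfl; unfold side at hs; split_ifs at hs <;> omega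
      have hlu : l ≠ u := by
        rintro rfl; unfold side at hs; split_ifs at hs <;> omega
      rw [← theta_St u k hku, ← theta_St u l hlu]
      exact hf.2 k l hkl hku hlu _ (clean_St u k hku A hk _ _) (clean_St u l hlu A hl _ _)
    have far := far_swap u (fun A => f (St u A (decide ((u, false) ∈ S))
      (decide ((u, true) ∈ S)))) hadj
    intro k l A hs hk hl
    rcases le_total k.val l.val with h | h
    · exact far (l.val - k.val) k l A (by omega) hs hk hl
    · exact (far (k.val - l.val) l k A (by omega) hs.symm hl hk).symm
  · intro s
    have hside : ∀ k : Fin m, side u k = 1 ↔ k = u := by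
      intro k; rw [Fin.ext_iff]; unfold side; split_ifs <;> simp <;> omega
    have hse : ∀ s, s ≠ 1 → ((supp S).erase u).filter (fun k => side u k = s)
        = (supp S).filter (fun k => side u k = s) := by
      intro s hs
      rw [Finset.filter_erase, Finset.erase_eq_of_notMem]
      simp [(hside u).2 rfl, hs.symm]
    by_cases h0 : s = 0
    · subst h0
      rw [card_canon0 u _ _ (cnt_le0 u S), hse 0 (by simp)]; rfl
    by_cases h2 : s = 2
    · subst h2
      rw [card_canon2 u _ _ (cnt_le2 u S), hse 2 (by simp)]; rfl
    by_cases h1 : s = 1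
    · subst h1
      simp only [hside]
      rw [Finset.filter_eq', Finset.filter_eq', if_neg (by simp), if_neg (by simp [canon])]
    · have hn : ∀ k : Fin m, side u k ≠ s := by
        intro k; unfold side; split_ifs <;> omega
      simp [hn]

def GoodSub {m : ℕ} (u : Fin m) : Submodule ℚ (M m) where
  carrier := {f | Good u f}
  add_mem' := by
    rintro f g ⟨h1, h2⟩ ⟨h3, h4⟩
    refine ⟨fun k hk S hS => ?_, fun k l hkl hk hl R hR1 hR2 => ?_⟩
    · simp [h1 k hk S hS, h3 k hk S hS]
    · simp [h2 k l hkl hk hl R hR1 hR2, h4 k l hkl hk hl R hR1 hR2]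
  zero_mem' := ⟨fun k hk S hS => rfl, fun k l hkl hk hl R hR1 hR2 => rfl⟩
  smul_mem' := by
    rintro c f ⟨h1, h2⟩
    refine ⟨fun k hk S hS => ?_, fun k l hkl hk hl R hR1 hR2 => ?_⟩
    · simp [h1 k hk S hS]
    · simp [h2 k l hkl hk hl R hR1 hR2]

abbrev G {m : ℕ} (u : Fin m) := Fin (u.val + 1) × Fin (m - u.val) × Bool × Bool

def ev {m : ℕ} (u : Fin m) : GoodSub u →ₗ[ℚ] (G u → ℚ) where
  toFun f i := f.1 (St u (canon u i.1 i.2.1) i.2.2.1 i.2.2.2)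
  map_add' f g := rfl
  map_smul' c f := rfl

lemma ev_inj {m : ℕ} (u : Fin m) : Function.Injective (ev u) := by
  rw [injective_iff_map_eq_zero]
  rintro ⟨f, hf⟩ h
  apply Subtype.ext
  ext S
  change f S = 0
  by_cases hS : AllBal u S
  · rw [good_eval u f hf S hS]
    have h0 := cnt_le0 u S
    have h2 := cnt_le2 u S
    exact congrFun h (⟨cnt u 0 S, by omega⟩, ⟨cnt u 2 S, by omega⟩, decide ((u, false) ∈ S),
      decide ((u, true) ∈ S))
  · unfold AllBal at hS
    push Not at hS
    obtain ⟨k, hk, h⟩ := hS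
    apply hf.1 k hk S
    tauto

open Classical in
def psi {m : ℕ} (u : Fin m) (g : G u → ℚ) : M m := fun S =>
  if AllBal u S then
    g (⟨cnt u 0 S, by have := cnt_le0 u S; omega⟩, ⟨cnt u 2 S, by have := cnt_le2 u S; omega⟩,
      decide ((u, false) ∈ S), decide ((u, true) ∈ S))
  else 0

lemma psi_congr {m : ℕ} (u : Fin m) (g : G u → ℚ) (S S' : Finset (Idx m))
    (h : AllBal u S ↔ AllBal u S') (h0 : cnt u 0 S = cnt u 0 S') (h2 : cnt u 2 S = cnt u 2 S')
    (hu : ∀ b, (u, b) ∈ S ↔ (u, b) ∈ S') : psi u g S = psi u g S' := by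
  unfold psi
  by_cases hS : AllBal u S
  · rw [if_pos hS, if_pos (h.1 hS)]
    simp only [h0, h2, hu]
  · rw [if_neg hS, if_neg (fun h' => hS (h.2 h'))]

lemma cnt_theta {m : ℕ} (u k : Fin m) (s : ℕ) (R : Finset (Idx m)) (hR : Clean k R) :
    cnt u s (theta k R) = cnt u s R + if side u k = s then 1 else 0 := by
  have : supp (theta k R) = insert k (supp R) := by
    ext j; simp [supp, theta]
  have hk : k ∉ supp R := by simp [supp, hR false]
  unfold cnt
  rw [this, Finset.filter_insert]
  split_ifs
  · rw [Finset.card_insert_of_notMem (by simp [hk])]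
  · rfl

lemma allBal_theta {m : ℕ} (u k : Fin m) (R : Finset (Idx m)) (hR : Clean k R) :
    AllBal u (theta k R) ↔ AllBal u R := by
  unfold AllBal
  refine forall_congr' fun j => ?_
  by_cases hj : j = k
  · subst hj; simp [theta, hR false, hR true]
  · simp [theta, hj]

lemma psi_good {m : ℕ} (u : Fin m) (g : G u → ℚ) : Good u (psi u g) := by
  refine ⟨fun k hk S hS => ?_, fun k l hkl hk hl R hRk hRl => ?_⟩
  · unfold psi
    rw [if_neg]
    intro h
    exact hS (h k hk)
  · have hs : side u k = side u l := by
      have h1 : k.val ≠ u.val := fun h => hk (Fin.ext h)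
      have h2 : l.val ≠ u.val := fun h => hl (Fin.ext h)
      unfold side; split_ifs <;> omega
    apply psi_congr
    · rw [allBal_theta u k R hRk, allBal_theta u l R hRl]
    · rw [cnt_theta u k 0 R hRk, cnt_theta u l 0 R hRl, hs]
    · rw [cnt_theta u k 2 R hRk, cnt_theta u l 2 R hRl, hs]
    · intro b; simp [theta, Ne.symm hk, Ne.symm hl]

lemma ev_surj {m : ℕ} (u : Fin m) : Function.Surjective (ev u) := by
  intro g
  refine ⟨⟨psi u g, psi_good u g⟩, ?_⟩
  ext ⟨a, b, x, y⟩
  change psi u g (St u (canon u a b) x y) = _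
  have hsu : side u u = 1 := by simp [side]
  have hf : ∀ s, s ≠ 1 → cnt u s (St u (canon u a b) x y) =
      ((canon u a b).filter fun k => side u k = s).card := by
    intro s hs
    unfold cnt
    congr 1
    ext k
    simp only [supp, Finset.mem_filter, Finset.mem_univ, true_and, mem_St]
    by_cases hk : k = u
    · subst hk; simp [hsu, hs.symm]
    · simp [hk]
  have h0 := (hf 0 (by simp)).trans (card_canon0 u a b (by omega))
  have h2 := (hf 2 (by simp)).trans (card_canon2 u a b (by omega))
  unfold psi
  rw [if_pos]
  · simp only [h0, h2, mem_St]
    simp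
  · intro k hk
    simp [mem_St, hk]

lemma finrank_good {m : ℕ} (u : Fin m) :
    Module.finrank ℚ (GoodSub u) = (u.val + 1) * ((m - u.val) * 4) := by
  rw [(LinearEquiv.ofBijective (ev u) ⟨ev_inj u, ev_surj u⟩).finrank_eq]
  simp

end Fock

/-- Lemma 4.3.3, case 3: for odd `t` with `1 ≤ t ≤ 2m - 1` and
`I'' = {2, …, t} ∪ {t + 2, …, 2m}`, the space of `T_{I''}`-invariants in `⋀ U`
has dimension `(t + 1)(2m - t + 1)`. -/
theorem invariants_dim_case3 (m t : ℕ) (hm : 1 ≤ m)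
    (ht : Odd t) (ht1 : 1 ≤ t) (ht2 : t ≤ 2 * m - 1) :
    Module.finrank ℚ
      (invSub (2 * m) {i | (2 ≤ i ∧ i ≤ t) ∨ (t + 2 ≤ i ∧ i ≤ 2 * m)})
    = (t + 1) * (2 * m - t + 1) := by
  obtain ⟨n, rfl⟩ := ht
  obtain ⟨u, rfl⟩ : ∃ u : Fin m, u.val = n := ⟨⟨n, by omega⟩, rfl⟩
  let e := LinearEquiv.ofBijective (Fock.Phi (Fock.aMap m u))
    (Fock.Phi_bij (Fock.aMap m u) (Fock.aMap_surj u))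
  have h : invSub (2 * m)
      {i | (2 ≤ i ∧ i ≤ 2 * u.val + 1) ∨ (2 * u.val + 1 + 2 ≤ i ∧ i ≤ 2 * m)}
      = (Fock.GoodSub u).comap e.toLinearMap := by
    ext x
    rw [Fock.mem_inv, Fock.cond_iff_good]
    rfl
  rw [h, Submodule.comap_equiv_eq_map_symm, LinearEquiv.finrank_map_eq, Fock.finrank_good]
  obtain ⟨r, hr⟩ : ∃ r, m = u.val + r := ⟨m - u.val, by omega⟩
  rw [show m - u.val = r by omega, show 2 * m - (2 * u.val + 1) + 1 = 2 * r by omega]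
  ring

end
end
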